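/- arXiv:1307.1634 — 10 statements merged into one kernel-verified Lean document; each statement's English description precedes it below -/
import Mathlib

section
/- Let g ∈ Sp(V,Ω). Then for every nonzero v ∈ V one has 4Ω(C_g v, jC_g v) = 2Ω(v,jv) + Ω(gv,jgv) + Ω(gjv,jgjv) > 0; consequently the j-linear part C_g = ½(g − j∘g∘j) of any symplectic automorphism g is invertible. -/
/-- For a symplectic automorphism `g` of a finite-dimensional real
symplectic vector space `(V, Ω)` with positive compatible complex structure `j`,
one has `4Ω(C_g v, j C_g v) = 2Ω(v,jv) + Ω(gv,jgv) + Ω(gjv,jgjv) > 0` for `v ≠ 0`,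
and consequently `C_g := ½(g − j∘g∘j)` is invertible. -/
theorem stmt0 {V : Type*} [AddCommGroup V] [Module ℝ V] [FiniteDimensional ℝ V]
    (Ω : V →ₗ[ℝ] V →ₗ[ℝ] ℝ)
    (hΩalt : ∀ v, Ω v v = 0)
    (hΩnondeg : ∀ v, (∀ w, Ω v w = 0) → v = 0)
    (j : Module.End ℝ V)
    (hj2 : j * j = -1)
    (hjsymp : ∀ v w, Ω (j v) (j w) = Ω v w)
    (hjpos : ∀ v, v ≠ 0 → 0 < Ω v (j v))
    (g : Module.End ℝ V)
    (hgbij : Function.Bijective g)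
    (hgsymp : ∀ v w, Ω (g v) (g w) = Ω v w) :
    (∀ v, v ≠ 0 →
      4 * Ω (((1/2 : ℝ) • (g - j * g * j)) v) (j (((1/2 : ℝ) • (g - j * g * j)) v))
          = 2 * Ω v (j v) + Ω (g v) (j (g v)) + Ω (g (j v)) (j (g (j v)))
        ∧ 0 < 4 * Ω (((1/2 : ℝ) • (g - j * g * j)) v)
            (j (((1/2 : ℝ) • (g - j * g * j)) v)))
      ∧ Function.Bijective ((1/2 : ℝ) • (g - j * g * j)) := by
  have hjj (v : V) : j (j v) = -v := by simpa using LinearMap.congr_fun hj2 v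
  have hanti (v w : V) : Ω v w = -Ω w v := (LinearMap.IsAlt.neg hΩalt w v).symm
  have hnonneg (v : V) : 0 ≤ Ω v (j v) := by
    rcases eq_or_ne v 0 with rfl | hv
    · simp
    · exact (hjpos v hv).le
  have key (v : V) :
      4 * Ω (((1/2 : ℝ) • (g - j * g * j)) v) (j (((1/2 : ℝ) • (g - j * g * j)) v))
        = 2 * Ω v (j v) + Ω (g v) (j (g v)) + Ω (g (j v)) (j (g (j v))) := by
    simp only [LinearMap.smul_apply, LinearMap.sub_apply, Module.End.mul_apply, map_smul,
      map_sub, hjj, hjsymp, hgsymp, map_neg, smul_eq_mul]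
    rw [hanti (j v) v, hanti (j (g (j v)))]
    ring
  have pos (v : V) (hv : v ≠ 0) :
      0 < 4 * Ω (((1/2 : ℝ) • (g - j * g * j)) v) (j (((1/2 : ℝ) • (g - j * g * j)) v)) := by
    rw [key]
    linarith [hjpos v hv, hnonneg (g v), hnonneg (g (j v))]
  have inj : Function.Injective ((1/2 : ℝ) • (g - j * g * j)) := by
    refine (injective_iff_map_eq_zero _).2 fun v hv => ?_
    by_contra hne
    have h := pos v hne
    rw [hv] at h
    simp at h
  exact ⟨fun v hv => ⟨key v, pos v hv⟩, inj, LinearMap.injective_iff_surjective.1 inj⟩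
end

section
/- Let g ∈ Sp(V,Ω) and Z_g := C_g⁻¹∘D_g. Then: (i) Z_g∘j = −j∘Z_g (Z_g is j-antilinear); (ii) ⟨v, Z_g w⟩_j = ⟨w, Z_g v⟩_j for all v,w ∈ V; (iii) Id − Z_g² = (C_g*∘C_g)⁻¹, which is self-adjoint and positive definite. In particular Z_g belongs to the Siegel domain 𝔹(V,Ω,j). -/
/-- The Hermitean inner product `⟨v,w⟩_j := Ω(v,jw) − i·Ω(v,w)`. -/
noncomputable def herm {V : Type*} [AddCommGroup V] [Module ℝ V]
    (Ω : V →ₗ[ℝ] V →ₗ[ℝ] ℝ) (j : Module.End ℝ V) (v w : V) : ℂ :=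
  (Ω v (j w) : ℂ) - Complex.I * (Ω v w : ℂ)

/-- Membership in the Siegel domain `𝔹(V,Ω,j)`. -/
def InSiegel {V : Type*} [AddCommGroup V] [Module ℝ V]
    (Ω : V →ₗ[ℝ] V →ₗ[ℝ] ℝ) (j : Module.End ℝ V) (Z : Module.End ℝ V) : Prop :=
  Z * j = -(j * Z) ∧ (∀ v w, herm Ω j v (Z w) = herm Ω j w (Z v)) ∧
    (∀ v, v ≠ 0 → 0 < Ω ((1 - Z * Z) v) (j v))

/-- `C_g := ½(g − j∘g∘j)`. -/
noncomputable def Cmap {V : Type*} [AddCommGroup V] [Module ℝ V]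
    (j g : Module.End ℝ V) : Module.End ℝ V := (1/2 : ℝ) • (g - j * g * j)

/-- `D_g := ½(g + j∘g∘j)`. -/
noncomputable def Dmap {V : Type*} [AddCommGroup V] [Module ℝ V]
    (j g : Module.End ℝ V) : Module.End ℝ V := (1/2 : ℝ) • (g + j * g * j)

/-- `Z_g := C_g⁻¹ ∘ D_g`. -/
noncomputable def Zmap {V : Type*} [AddCommGroup V] [Module ℝ V]
    (j g : Module.End ℝ V) : Module.End ℝ V := Ring.inverse (Cmap j g) * Dmap j g

section SiegelAux

variable {V : Type*} [AddCommGroup V] [Module ℝ V]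

theorem mul_Cmap_eq_Cmap_mul {j : Module.End ℝ V} (hj2 : j * j = -1) (g : Module.End ℝ V) :
    j * Cmap j g = Cmap j g * j := by
  have h1 : j * (j * g * j) = -(g * j) := by
    rw [← mul_assoc, ← mul_assoc, hj2, neg_one_mul, neg_mul]
  have h2 : j * g * j * j = -(j * g) := by rw [mul_assoc, hj2, mul_neg_one]
  simp only [Cmap, mul_smul_comm, smul_mul_assoc, mul_sub, sub_mul, h1, h2]
  congr 1
  abel

theorem Dmap_mul_eq_neg_mul_Dmap {j : Module.End ℝ V} (hj2 : j * j = -1) (g : Module.End ℝ V) :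
    Dmap j g * j = -(j * Dmap j g) := by
  have h1 : j * (j * g * j) = -(g * j) := by
    rw [← mul_assoc, ← mul_assoc, hj2, neg_one_mul, neg_mul]
  have h2 : j * g * j * j = -(j * g) := by rw [mul_assoc, hj2, mul_neg_one]
  simp only [Dmap, mul_smul_comm, smul_mul_assoc, mul_add, add_mul, h1, h2, ← smul_neg]
  congr 1
  abel

theorem conj_mul_conj_of_mul_eq_one {j g h : Module.End ℝ V} (hj2 : j * j = -1)
    (hgh : g * h = 1) : j * g * j * (j * h * j) = 1 := by
  calc j * g * j * (j * h * j) = j * g * (j * j) * h * j := by simp only [mul_assoc]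
    _ = -(j * (g * h) * j) := by rw [hj2]; simp only [mul_assoc, neg_mul, mul_neg, one_mul]
    _ = 1 := by rw [hgh, mul_one, hj2, neg_neg]

theorem Cmap_mul_Cmap_add_Dmap_mul_Dmap {j g h : Module.End ℝ V} (hj2 : j * j = -1)
    (hgh : g * h = 1) : Cmap j g * Cmap j h + Dmap j g * Dmap j h = 1 := by
  have h1 := conj_mul_conj_of_mul_eq_one hj2 hgh
  simp only [Cmap, Dmap, mul_smul_comm, smul_mul_assoc, mul_add, add_mul, mul_sub, sub_mul, h1, hgh]
  module

theorem Cmap_mul_Dmap_add_Dmap_mul_Cmap {j g h : Module.End ℝ V} (hj2 : j * j = -1)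
    (hgh : g * h = 1) : Cmap j g * Dmap j h + Dmap j g * Cmap j h = 0 := by
  have h1 := conj_mul_conj_of_mul_eq_one hj2 hgh
  simp only [Cmap, Dmap, mul_smul_comm, smul_mul_assoc, mul_add, add_mul, mul_sub, sub_mul, h1, hgh]
  module

variable {Ω : V →ₗ[ℝ] V →ₗ[ℝ] ℝ} {j : Module.End ℝ V}

theorem apply_complexStructure_left (hj2 : j * j = -1)
    (hjsymp : ∀ v w, Ω (j v) (j w) = Ω v w) (v w : V) : Ω (j v) w = -Ω v (j w) := by
  have h : j (j v) = -v := by simpa using LinearMap.congr_fun hj2 v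
  rw [← hjsymp (j v) w, h, map_neg, LinearMap.neg_apply]

theorem herm_eq_herm {a b c d : V} (hre : Ω a (j b) = Ω c (j d)) (him : Ω a b = Ω c d) :
    herm Ω j a b = herm Ω j c d := by
  rw [herm, herm, hre, him]

theorem apply_eq_apply_of_herm_eq {a b c d : V} (h : herm Ω j a b = herm Ω j c d) :
    Ω a b = Ω c d := by
  simpa [herm] using congrArg Complex.im h

theorem apply_Cmap_left {g h : Module.End ℝ V} (hj2 : j * j = -1)
    (hjsymp : ∀ v w, Ω (j v) (j w) = Ω v w) (hadj : ∀ v w, Ω (g v) w = Ω v (h w)) (v w : V) :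
    Ω (Cmap j g v) w = Ω v (Cmap j h w) := by
  simp [Cmap, hadj, apply_complexStructure_left hj2 hjsymp]

theorem apply_Dmap_left {g h : Module.End ℝ V} (hj2 : j * j = -1)
    (hjsymp : ∀ v w, Ω (j v) (j w) = Ω v w) (hadj : ∀ v w, Ω (g v) w = Ω v (h w)) (v w : V) :
    Ω (Dmap j g v) w = Ω v (Dmap j h w) := by
  simp [Dmap, hadj, apply_complexStructure_left hj2 hjsymp]

theorem isUnit_Cmap [FiniteDimensional ℝ V] {g h : Module.End ℝ V} (hj2 : j * j = -1)
    (hjsymp : ∀ v w, Ω (j v) (j w) = Ω v w) (hjpos : ∀ v, v ≠ 0 → 0 < Ω v (j v))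
    (hhg : h * g = 1) (hadj : ∀ v w, Ω (g v) w = Ω v (h w)) : IsUnit (Cmap j g) := by
  rw [LinearMap.isUnit_iff_ker_eq_bot, LinearMap.ker_eq_bot']
  intro v hv
  by_contra hne
  have hDj : Dmap j g (j v) = -j (Dmap j g v) :=
    LinearMap.congr_fun (Dmap_mul_eq_neg_mul_Dmap hj2 g) v
  have hCj : Cmap j g (j v) = 0 := by
    simpa [hv] using (LinearMap.congr_fun (mul_Cmap_eq_Cmap_mul hj2 g) v).symm
  have hsum := LinearMap.congr_fun (Cmap_mul_Cmap_add_Dmap_mul_Dmap hj2 hhg) (j v)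
  simp only [LinearMap.add_apply, Module.End.mul_apply, hCj, map_zero, zero_add, hDj,
    Module.End.one_apply] at hsum
  have hpos := hjpos v hne
  rw [← hsum, ← apply_Dmap_left hj2 hjsymp hadj, map_neg] at hpos
  by_cases hD : Dmap j g v = 0
  · simp [hD] at hpos
  · linarith [hjpos _ hD]

end SiegelAux

/-- for a symplectic automorphism `g`, `Z_g` is `j`-antilinear,
`⟨v,Z_g w⟩_j = ⟨w,Z_g v⟩_j`, and `Id − Z_g² = (C_g* ∘ C_g)⁻¹` is self-adjoint
and positive definite; in particular `Z_g` lies in the Siegel domain. -/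
theorem stmt1 {V : Type*} [AddCommGroup V] [Module ℝ V] [FiniteDimensional ℝ V]
    (Ω : V →ₗ[ℝ] V →ₗ[ℝ] ℝ)
    (hΩalt : ∀ v, Ω v v = 0)
    (hΩnondeg : ∀ v, (∀ w, Ω v w = 0) → v = 0)
    (j : Module.End ℝ V)
    (hj2 : j * j = -1)
    (hjsymp : ∀ v w, Ω (j v) (j w) = Ω v w)
    (hjpos : ∀ v, v ≠ 0 → 0 < Ω v (j v))
    (g : Module.End ℝ V)
    (hgbij : Function.Bijective g)
    (hgsymp : ∀ v w, Ω (g v) (g w) = Ω v w)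
    -- `Cs` is the adjoint `C_g*` of `C_g` with respect to `⟨·,·⟩_j`:
    (Cs : Module.End ℝ V)
    (hCs : ∀ v w, herm Ω j (Cmap j g v) w = herm Ω j v (Cs w)) :
    Zmap j g * j = -(j * Zmap j g)
    ∧ (∀ v w, herm Ω j v (Zmap j g w) = herm Ω j w (Zmap j g v))
    ∧ (1 - Zmap j g * Zmap j g) * (Cs * Cmap j g) = 1
    ∧ (Cs * Cmap j g) * (1 - Zmap j g * Zmap j g) = 1
    ∧ (∀ v w, herm Ω j ((1 - Zmap j g * Zmap j g) v) w
        = herm Ω j v ((1 - Zmap j g * Zmap j g) w))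
    ∧ (∀ v, v ≠ 0 → 0 < Ω ((1 - Zmap j g * Zmap j g) v) (j v))
    ∧ InSiegel Ω j (Zmap j g) := by
  obtain ⟨h, hgh, hhg⟩ : ∃ h : Module.End ℝ V, g * h = 1 ∧ h * g = 1 := by
    obtain ⟨u, rfl⟩ := (Module.End.isUnit_iff g).2 hgbij
    exact ⟨_, u.mul_inv, u.inv_mul⟩
  have hadj : ∀ v w, Ω (g v) w = Ω v (h w) := fun v w => by
    have hw : g (h w) = w := LinearMap.congr_fun hgh w
    rw [← hgsymp v (h w), hw]
  have hskew : ∀ v w, Ω v w = -Ω w v := fun v w => by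
    have := hΩalt (v + w)
    simp only [map_add, LinearMap.add_apply, hΩalt] at this
    linarith
  have hCadj := apply_Cmap_left hj2 hjsymp hadj
  have hDadj := apply_Dmap_left hj2 hjsymp hadj
  have hCs_eq : Cs = Cmap j h := by
    ext w
    rw [← sub_eq_zero]
    refine hΩnondeg _ fun v => ?_
    rw [hskew, map_sub, ← hCadj, apply_eq_apply_of_herm_eq (hCs v w), sub_self, neg_zero]
  subst hCs_eq
  obtain ⟨u, hu⟩ := isUnit_Cmap hj2 hjsymp hjpos hhg hadj
  have hCD := Cmap_mul_Dmap_add_Dmap_mul_Cmap hj2 hgh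
  have hCC := Cmap_mul_Cmap_add_Dmap_mul_Dmap hj2 hgh
  have hjC := mul_Cmap_eq_Cmap_mul hj2 g
  have hDj := Dmap_mul_eq_neg_mul_Dmap hj2 g
  have hCZ : Cmap j g * Zmap j g = Dmap j g := by
    rw [Zmap, ← mul_assoc, Ring.mul_inverse_cancel _ ⟨u, hu⟩, one_mul]
  generalize Zmap j g = Z at *
  generalize Cmap j g = C at *
  generalize Dmap j g = D at *
  generalize Cmap j h = C' at *
  generalize Dmap j h = D' at *
  subst hu hCZ
  have hZC : Z * C' = -D' := by
    rw [← u.mul_right_inj, mul_neg, ← mul_assoc]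
    exact eq_neg_of_add_eq_zero_right hCD
  have hZj : Z * j = -(j * Z) := by
    rw [← u.mul_right_inj, ← mul_assoc, hDj, mul_neg, ← mul_assoc, ← mul_assoc, hjC]
  have hinv : u * ((1 - Z * Z) * C') = 1 := by
    rw [sub_mul, one_mul, mul_assoc Z, hZC, mul_neg, sub_neg_eq_add, mul_add, ← mul_assoc, hCC]
  have hinv₁ : (1 - Z * Z) * (C' * u) = 1 := by
    rw [← mul_assoc]
    exact mul_eq_one_comm.1 hinv
  have hinv₂ : (C' * u) * (1 - Z * Z) = 1 := mul_eq_one_comm.1 hinv₁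
  have hC'surj : ∀ w, ∃ x, C' x = w := fun w =>
    ⟨(u.1 * (1 - Z * Z)) w, LinearMap.congr_fun hinv₂ w⟩
  have hZadj : ∀ v w, Ω (Z v) w = -Ω v (Z w) := fun v w => by
    obtain ⟨x, rfl⟩ := hC'surj w
    have hx : Z (C' x) = -D' x := LinearMap.congr_fun hZC x
    rw [hx, map_neg, neg_neg, ← hCadj, ← hDadj, Module.End.mul_apply]
  have hjadj := apply_complexStructure_left hj2 hjsymp
  have hZj' : ∀ v, Z (j v) = -j (Z v) := LinearMap.congr_fun hZj
  have hsymm : ∀ v w, herm Ω j v (Z w) = herm Ω j w (Z v) := fun v w =>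
    herm_eq_herm
      (by rw [hskew, hjadj, neg_neg, hZadj, hZj', map_neg, neg_neg])
      (by rw [hskew, hZadj, neg_neg])
  have hpos : ∀ v, v ≠ 0 → 0 < Ω ((1 - Z * Z) v) (j v) := fun v hv => by
    have hv' : C' (u.1 ((1 - Z * Z) v)) = v := LinearMap.congr_fun hinv₂ v
    have hne : u.1 ((1 - Z * Z) v) ≠ 0 := fun h0 => hv (by rw [← hv', h0, map_zero])
    have hjC' : ∀ x, j (u.1 x) = u.1 (j x) := LinearMap.congr_fun hjC
    refine (hjpos _ hne).trans_eq ?_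
    have := hCadj (j ((1 - Z * Z) v)) (u.1 ((1 - Z * Z) v))
    rw [hv', ← hjC', hjadj, hjadj] at this
    exact neg_injective this
  refine ⟨hZj, hsymm, hinv₁, hinv₂, fun v w => herm_eq_herm ?_ ?_, hpos, hZj, hsymm, hpos⟩
  · simp [hZadj, hZj']
  · simp [hZadj]
end

section
/- If Z₁, Z₂ ∈ 𝔹(V,Ω,j), then Id − Z₁∘Z₂ is j-linear (ℂ-linear) and invertible, and its self-adjoint (real) part ½((Id − Z₁Z₂) + (Id − Z₁Z₂)*) = ½((Id − Z₁Z₂) + (Id − Z₂Z₁)) is positive definite. -/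
theorem herm_eq_iff {V : Type*} [AddCommGroup V] [Module ℝ V]
    {Ω : V →ₗ[ℝ] V →ₗ[ℝ] ℝ} {j : Module.End ℝ V} {v w v' w' : V} :
    herm Ω j v w = herm Ω j v' w' ↔ Ω v (j w) = Ω v' (j w') ∧ Ω v w = Ω v' w' := by
  simp [herm, Complex.ext_iff]

/-- for `Z₁, Z₂ ∈ 𝔹(V,Ω,j)`, `Id − Z₁∘Z₂` is `j`-linear and
invertible, its adjoint is `Id − Z₂∘Z₁`, and its self-adjoint (real) part
`½((Id − Z₁Z₂) + (Id − Z₂Z₁))` is positive definite. -/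
theorem stmt4 {V : Type*} [AddCommGroup V] [Module ℝ V] [FiniteDimensional ℝ V]
    (Ω : V →ₗ[ℝ] V →ₗ[ℝ] ℝ)
    (hΩalt : ∀ v, Ω v v = 0)
    (hΩnondeg : ∀ v, (∀ w, Ω v w = 0) → v = 0)
    (j : Module.End ℝ V)
    (hj2 : j * j = -1)
    (hjsymp : ∀ v w, Ω (j v) (j w) = Ω v w)
    (hjpos : ∀ v, v ≠ 0 → 0 < Ω v (j v))
    (Z₁ Z₂ : Module.End ℝ V)
    (hZ₁ : InSiegel Ω j Z₁) (hZ₂ : InSiegel Ω j Z₂) :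
    (1 - Z₁ * Z₂) * j = j * (1 - Z₁ * Z₂)
    ∧ IsUnit (1 - Z₁ * Z₂)
    ∧ (∀ v w, herm Ω j ((1 - Z₁ * Z₂) v) w = herm Ω j v ((1 - Z₂ * Z₁) w))
    ∧ (∀ v, v ≠ 0 →
        0 < Ω (((1/2 : ℝ) • ((1 - Z₁ * Z₂) + (1 - Z₂ * Z₁))) v) (j v)) := by
  obtain ⟨hc₁, hs₁, hp₁⟩ := hZ₁
  obtain ⟨hc₂, hs₂, hp₂⟩ := hZ₂
  have skew : ∀ v w, Ω v w = -Ω w v := fun v w => by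
    have h := hΩalt (v + w)
    simp only [map_add, LinearMap.add_apply, hΩalt] at h
    linarith
  have jj : ∀ v, j (j v) = -v := fun v => by
    simpa using LinearMap.congr_fun hj2 v
  have symm : ∀ v w, Ω v (j w) = Ω w (j v) := fun v w => by
    rw [← hjsymp v (j w), jj, map_neg, skew w (j v)]
  have re₁ : ∀ v w, Ω v (j (Z₁ w)) = Ω w (j (Z₁ v)) := fun v w =>
    (herm_eq_iff.1 (hs₁ v w)).1
  have re₂ : ∀ v w, Ω v (j (Z₂ w)) = Ω w (j (Z₂ v)) := fun v w =>
    (herm_eq_iff.1 (hs₂ v w)).1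
  have im₁ : ∀ v w, Ω v (Z₁ w) = Ω w (Z₁ v) := fun v w =>
    (herm_eq_iff.1 (hs₁ v w)).2
  have im₂ : ∀ v w, Ω v (Z₂ w) = Ω w (Z₂ v) := fun v w =>
    (herm_eq_iff.1 (hs₂ v w)).2
  have cross : ∀ v, v ≠ 0 → Ω (Z₁ v) (j (Z₂ v)) < Ω v (j v) := fun v hv => by
    have h₁ := hp₁ v hv
    have h₂ := hp₂ v hv
    simp only [LinearMap.sub_apply, Module.End.one_apply, Module.End.mul_apply, map_sub] at h₁ h₂
    rw [symm (Z₁ (Z₁ v)) v, re₁ v (Z₁ v)] at h₁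
    rw [symm (Z₂ (Z₂ v)) v, re₂ v (Z₂ v)] at h₂
    have h : 0 ≤ Ω (Z₁ v - Z₂ v) (j (Z₁ v - Z₂ v)) := by
      by_cases h0 : Z₁ v - Z₂ v = 0
      · simp [h0]
      · exact (hjpos _ h0).le
    simp only [LinearMap.sub_apply, map_sub] at h
    have := symm (Z₁ v) (Z₂ v)
    linarith
  have move₁ : ∀ v, Ω (Z₁ (Z₂ v)) (j v) = Ω (Z₁ v) (j (Z₂ v)) := fun v => by
    rw [symm, re₁, symm]
  have move₂ : ∀ v, Ω (Z₂ (Z₁ v)) (j v) = Ω (Z₁ v) (j (Z₂ v)) := fun v => by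
    rw [symm, re₂]
  refine ⟨?_, ?_, fun v w => ?_, fun v hv => ?_⟩
  · rw [sub_mul, mul_sub, one_mul, mul_one, mul_assoc, hc₂, mul_neg, ← mul_assoc, hc₁,
      neg_mul, neg_neg, mul_assoc]
  · rw [LinearMap.isUnit_iff_ker_eq_bot, LinearMap.ker_eq_bot']
    intro v hv
    by_contra h0
    have hlt := cross v h0
    have heq : Z₁ (Z₂ v) = v := by
      exact (sub_eq_zero.1 hv).symm
    rw [← move₁, heq] at hlt
    exact lt_irrefl _ hlt
  · rw [herm_eq_iff]
    simp only [LinearMap.sub_apply, Module.End.one_apply, Module.End.mul_apply, map_sub]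
    rw [symm (Z₁ (Z₂ v)) w, re₁ w, symm (Z₂ v), re₂ v, skew (Z₁ (Z₂ v)) w, im₁ w,
      skew (Z₂ v), im₂ v]
    simp
  · have := cross v hv
    simp only [LinearMap.smul_apply, LinearMap.add_apply, LinearMap.sub_apply,
      Module.End.one_apply, Module.End.mul_apply, map_sub, map_add, map_smul, smul_eq_mul,
      move₁, move₂]
    linarith
end

section
/- Let ħ > 0 and let Pol(V,j) denote the space of holomorphic polynomial functions on the complex vector space (V,j), i.e. the subalgebra of functions V → ℂ generated by the ℂ-linear functionals on (V,j). For v ∈ V define cl(v) : Pol(V,j) → (functions V → ℂ) by (cl(v)f)(z) = (1/2ħ)⟨z,v⟩_j f(z) − (∂f)_z(v), where (∂f)_z(v) is the directional derivative of f at z in direction v. Then cl(v) maps Pol(V,j) into itself, and for all v,w ∈ V one has cl(v)∘cl(w) − cl(w)∘cl(v) = (i/ħ)Ω(v,w)·Id on Pol(V,j). -/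
/-- The space `Pol(V,j)` of holomorphic polynomial functions on the complex
vector space `(V,j)`: the subalgebra of functions `V → ℂ` generated by the
`ℂ`-linear functionals. -/
noncomputable def Pol (V : Type*) [AddCommGroup V] [Module ℂ V] : Subalgebra ℂ (V → ℂ) :=
  Algebra.adjoin ℂ (Set.range fun φ : V →ₗ[ℂ] ℂ => (φ : V → ℂ))

/-- The symplectic Clifford multiplication
`(cl(v)f)(z) = (1/2ħ)·⟨z,v⟩_j·f(z) − (∂f)_z(v)`, where `⟨z,v⟩_j = Ω(z,jv) − iΩ(z,v)`
(`j` being multiplication by `i`) and `(∂f)_z(v)` is the directional derivative. -/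
noncomputable def clOp {V : Type*} [AddCommGroup V] [Module ℂ V]
    (hbar : ℝ) (Ω : V →ₗ[ℝ] V →ₗ[ℝ] ℝ) (v : V) (f : V → ℂ) : V → ℂ :=
  fun z => (1 / (2 * (hbar : ℂ)))
      * ((Ω z (Complex.I • v) : ℂ) - Complex.I * (Ω z v : ℂ)) * f z
    - lineDeriv ℝ f z v

section PolynomialFunctions

variable {V : Type*} [AddCommGroup V] [Module ℂ V]

theorem linear_mem_Pol (φ : V →ₗ[ℂ] ℂ) : (φ : V → ℂ) ∈ Pol V :=
  Algebra.subset_adjoin ⟨φ, rfl⟩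

theorem HasLineDerivAt.fun_mul_complex {f g : V → ℂ} {f' g' : ℂ} {z v : V}
    (hf : HasLineDerivAt ℝ f f' z v) (hg : HasLineDerivAt ℝ g g' z v) :
    HasLineDerivAt ℝ (fun z => f z * g z) (f' * g z + f z * g') z v := by
  have h := HasDerivAt.fun_mul (𝕜 := ℝ) hf hg
  simpa [HasLineDerivAt] using h

theorem hasLineDerivAt_linear (φ : V →ₗ[ℂ] ℂ) (z v : V) :
    HasLineDerivAt ℝ φ (φ v) z v := by
  have h := (((hasDerivAt_id (0 : ℝ)).ofReal_comp).mul_const (φ v)).const_add (φ z)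
  have e : (fun t : ℝ => φ (z + t • v)) = fun t : ℝ => φ z + ((id t : ℝ) : ℂ) * φ v := by
    funext t
    rw [map_add, ← Complex.coe_smul, map_smul, smul_eq_mul, id]
  rw [HasLineDerivAt, e]
  simpa using h

theorem lineDeriv_linear (φ : V →ₗ[ℂ] ℂ) (v : V) :
    (fun z => lineDeriv ℝ φ z v) = fun _ => φ v :=
  funext fun z => (hasLineDerivAt_linear φ z v).lineDeriv

theorem Pol.lineDifferentiableAt_and_lineDeriv_mem {f : V → ℂ} (hf : f ∈ Pol V) (v : V) :
    (∀ z, LineDifferentiableAt ℝ f z v) ∧ (fun z => lineDeriv ℝ f z v) ∈ Pol V := by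
  induction hf using Algebra.adjoin_induction with
  | mem f hf =>
    obtain ⟨φ, rfl⟩ := hf
    refine ⟨fun z => (hasLineDerivAt_linear φ z v).lineDifferentiableAt, ?_⟩
    simp only [lineDeriv_linear]
    exact (Pol V).algebraMap_mem (φ v)
  | algebraMap r =>
    have h (z : V) : HasLineDerivAt ℝ (algebraMap ℂ (V → ℂ) r) 0 z v :=
      hasDerivAt_const (0 : ℝ) r
    refine ⟨fun z => (h z).lineDifferentiableAt, ?_⟩
    rw [funext fun z => (h z).lineDeriv]
    exact (Pol V).zero_mem
  | add f g hf hg ihf ihg =>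
    have h (z : V) : HasLineDerivAt ℝ (f + g) (lineDeriv ℝ f z v + lineDeriv ℝ g z v) z v :=
      HasDerivAt.add (ihf.1 z).hasLineDerivAt (ihg.1 z).hasLineDerivAt
    refine ⟨fun z => (h z).lineDifferentiableAt, ?_⟩
    rw [funext fun z => (h z).lineDeriv]
    exact (Pol V).add_mem ihf.2 ihg.2
  | mul f g hf hg ihf ihg =>
    have h (z : V) := (ihf.1 z).hasLineDerivAt.fun_mul_complex (ihg.1 z).hasLineDerivAt
    refine ⟨fun z => (h z).lineDifferentiableAt, ?_⟩
    have e : (fun z => lineDeriv ℝ (f * g) z v) = _ := funext fun z => (h z).lineDeriv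
    rw [e]
    exact (Pol V).add_mem ((Pol V).mul_mem ihf.2 hg) ((Pol V).mul_mem hf ihg.2)

theorem Pol.hasLineDerivAt {f : V → ℂ} (hf : f ∈ Pol V) (z v : V) :
    HasLineDerivAt ℝ f (lineDeriv ℝ f z v) z v :=
  ((lineDifferentiableAt_and_lineDeriv_mem hf v).1 z).hasLineDerivAt

theorem Pol.lineDeriv_mem {f : V → ℂ} (hf : f ∈ Pol V) (v : V) :
    (fun z => lineDeriv ℝ f z v) ∈ Pol V :=
  (lineDifferentiableAt_and_lineDeriv_mem hf v).2

theorem Pol.lineDeriv_add {f g : V → ℂ} (hf : f ∈ Pol V) (hg : g ∈ Pol V) (z v : V) :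
    lineDeriv ℝ (fun z => f z + g z) z v = lineDeriv ℝ f z v + lineDeriv ℝ g z v :=
  HasLineDerivAt.lineDeriv
    (HasDerivAt.fun_add (Pol.hasLineDerivAt hf z v) (Pol.hasLineDerivAt hg z v))

theorem Pol.lineDeriv_sub {f g : V → ℂ} (hf : f ∈ Pol V) (hg : g ∈ Pol V) (z v : V) :
    lineDeriv ℝ (fun z => f z - g z) z v = lineDeriv ℝ f z v - lineDeriv ℝ g z v :=
  HasLineDerivAt.lineDeriv
    (HasDerivAt.fun_sub (Pol.hasLineDerivAt hf z v) (Pol.hasLineDerivAt hg z v))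

theorem Pol.lineDeriv_mul {f g : V → ℂ} (hf : f ∈ Pol V) (hg : g ∈ Pol V) (z v : V) :
    lineDeriv ℝ (fun z => f z * g z) z v
      = lineDeriv ℝ f z v * g z + f z * lineDeriv ℝ g z v :=
  ((Pol.hasLineDerivAt hf z v).fun_mul_complex (Pol.hasLineDerivAt hg z v)).lineDeriv

theorem lineDeriv_const_fun (c : ℂ) (z v : V) : lineDeriv ℝ (fun _ : V => c) z v = 0 :=
  HasLineDerivAt.lineDeriv (hasDerivAt_const (0 : ℝ) c)

theorem Pol.lineDeriv_comm {f : V → ℂ} (hf : f ∈ Pol V) (v w z : V) :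
    lineDeriv ℝ (fun y => lineDeriv ℝ f y w) z v
      = lineDeriv ℝ (fun y => lineDeriv ℝ f y v) z w := by
  induction hf using Algebra.adjoin_induction generalizing z with
  | mem f hf =>
    obtain ⟨φ, rfl⟩ := hf
    simp only [lineDeriv_linear, lineDeriv_const_fun]
  | algebraMap r =>
    have h (y u : V) : lineDeriv ℝ (algebraMap ℂ (V → ℂ) r) y u = 0 := lineDeriv_const_fun r y u
    simp only [h]
    simp only [lineDeriv_const_fun]
  | add f g hf hg ihf ihg =>
    have h (y u : V) : lineDeriv ℝ (f + g) y u = _ := Pol.lineDeriv_add hf hg y u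
    simp only [h]
    rw [Pol.lineDeriv_add (Pol.lineDeriv_mem hf w) (Pol.lineDeriv_mem hg w),
      Pol.lineDeriv_add (Pol.lineDeriv_mem hf v) (Pol.lineDeriv_mem hg v), ihf, ihg]
  | mul f g hf hg ihf ihg =>
    have h (y u : V) : lineDeriv ℝ (f * g) y u = _ := Pol.lineDeriv_mul hf hg y u
    have key (a b : V) : lineDeriv ℝ (fun y => lineDeriv ℝ (f * g) y b) z a
        = lineDeriv ℝ (fun y => lineDeriv ℝ f y b) z a * g z
          + lineDeriv ℝ f z b * lineDeriv ℝ g z a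
          + (lineDeriv ℝ f z a * lineDeriv ℝ g z b
            + f z * lineDeriv ℝ (fun y => lineDeriv ℝ g y b) z a) := by
      simp only [h]
      rw [Pol.lineDeriv_add (f := fun y => lineDeriv ℝ f y b * g y)
          (g := fun y => f y * lineDeriv ℝ g y b) ((Pol V).mul_mem (Pol.lineDeriv_mem hf b) hg)
          ((Pol V).mul_mem hf (Pol.lineDeriv_mem hg b)),
        Pol.lineDeriv_mul (Pol.lineDeriv_mem hf b) hg,
        Pol.lineDeriv_mul hf (Pol.lineDeriv_mem hg b)]
    rw [key, key, ihf, ihg]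
    ring

/-- The `ℂ`-linear functional `z ↦ (1/2ħ)·⟨z,v⟩_j`. -/
noncomputable def scaledHermitian (hbar : ℝ) (Ω : V →ₗ[ℝ] V →ₗ[ℝ] ℝ)
    (hjsymp : ∀ v w, Ω (Complex.I • v) (Complex.I • w) = Ω v w) (v : V) : V →ₗ[ℂ] ℂ where
  toFun z := (1 / (2 * (hbar : ℂ)))
      * ((Ω z (Complex.I • v) : ℂ) - Complex.I * (Ω z v : ℂ))
  map_add' x y := by
    simp only [map_add, LinearMap.add_apply, Complex.ofReal_add]
    ring
  map_smul' c z := by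
    have hI : Ω (Complex.I • z) v = -Ω z (Complex.I • v) := by
      rw [← hjsymp (Complex.I • z) v, smul_smul, Complex.I_mul_I, neg_one_smul, map_neg,
        LinearMap.neg_apply]
    have hc (u : V) : Ω (c • z) u = c.re * Ω z u + c.im * Ω (Complex.I • z) u := by
      have : c • z = c.re • z + c.im • (Complex.I • z) := by
        rw [← Complex.coe_smul, ← Complex.coe_smul, smul_smul, ← add_smul, Complex.re_add_im]
      rw [this]
      simp only [map_add, LinearMap.add_apply, map_smul, LinearMap.smul_apply, smul_eq_mul]
    rw [hc, hc, hI, hjsymp]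
    simp only [RingHom.id_apply, smul_eq_mul]
    nth_rewrite 5 [← Complex.re_add_im c]
    push_cast
    linear_combination (-(1 / (2 * (hbar : ℂ))) * c.im * Ω z v) * -Complex.I_sq

end PolynomialFunctions

/-- `cl(v)` maps `Pol(V,j)` into itself and
`cl(v)∘cl(w) − cl(w)∘cl(v) = (i/ħ)Ω(v,w)·Id` on `Pol(V,j)`. -/
theorem stmt9 {V : Type*} [AddCommGroup V] [Module ℂ V] [FiniteDimensional ℂ V]
    (hbar : ℝ) (hpos : 0 < hbar)
    (Ω : V →ₗ[ℝ] V →ₗ[ℝ] ℝ)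
    (hΩalt : ∀ v, Ω v v = 0)
    (hΩnondeg : ∀ v, (∀ w, Ω v w = 0) → v = 0)
    (hjsymp : ∀ v w, Ω (Complex.I • v) (Complex.I • w) = Ω v w)
    (hjpos : ∀ v, v ≠ 0 → 0 < Ω v (Complex.I • v)) :
    (∀ (v : V), ∀ f ∈ Pol V, clOp hbar Ω v f ∈ Pol V)
    ∧ (∀ (v w : V), ∀ f ∈ Pol V, ∀ z : V,
        clOp hbar Ω v (clOp hbar Ω w f) z - clOp hbar Ω w (clOp hbar Ω v f) z
          = Complex.I / (hbar : ℂ) * (Ω v w : ℂ) * f z) := by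
  have hcl (v : V) (f : V → ℂ) : clOp hbar Ω v f
      = fun z => scaledHermitian hbar Ω hjsymp v z * f z - lineDeriv ℝ f z v := rfl
  have hmul (v : V) {f : V → ℂ} (hf : f ∈ Pol V) :
      (fun z => scaledHermitian hbar Ω hjsymp v z * f z) ∈ Pol V :=
    (Pol V).mul_mem (linear_mem_Pol _) hf
  refine ⟨fun v f hf => (Pol V).sub_mem (hmul v hf) (Pol.lineDeriv_mem hf v),
    fun v w f hf z => ?_⟩
  have key (a b : V) : clOp hbar Ω a (clOp hbar Ω b f) z
      = scaledHermitian hbar Ω hjsymp a z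
          * (scaledHermitian hbar Ω hjsymp b z * f z - lineDeriv ℝ f z b)
        - (scaledHermitian hbar Ω hjsymp b a * f z
            + scaledHermitian hbar Ω hjsymp b z * lineDeriv ℝ f z a
          - lineDeriv ℝ (fun y => lineDeriv ℝ f y b) z a) := by
    simp only [hcl]
    rw [Pol.lineDeriv_sub (hmul b hf) (Pol.lineDeriv_mem hf b),
      Pol.lineDeriv_mul (linear_mem_Pol _) hf, (hasLineDerivAt_linear _ z a).lineDeriv]
  have hskew (a b : V) : Ω a b = -Ω b a := by
    have h := hΩalt (a + b)
    simp only [map_add, LinearMap.add_apply, hΩalt] at h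
    linarith
  have hsymm : Ω w (Complex.I • v) = Ω v (Complex.I • w) := by
    rw [hskew, ← hjsymp (Complex.I • v) w, smul_smul, Complex.I_mul_I, neg_one_smul, map_neg,
      LinearMap.neg_apply, neg_neg]
  have hcomm : scaledHermitian hbar Ω hjsymp v w - scaledHermitian hbar Ω hjsymp w v
      = Complex.I / (hbar : ℂ) * (Ω v w : ℂ) := by
    have hne : (hbar : ℂ) ≠ 0 := Complex.ofReal_ne_zero.mpr hpos.ne'
    simp only [scaledHermitian, LinearMap.coe_mk, AddHom.coe_mk]
    rw [hsymm, hskew w v]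
    push_cast
    field_simp
    ring
  rw [key, key, Pol.lineDeriv_comm hf v w z]
  linear_combination f z * hcomm
end

section
/- For every compatible complex structure j̃ on (V,Ω) (not necessarily positive) there exists a positive compatible complex structure j on (V,Ω) such that j∘j̃ = j̃∘j. -/
open Polynomial in
/-- A polynomial vanishing at every eigenvalue of a symmetric operator annihilates it. -/
theorem LinearMap.IsSymmetric.aeval_eq_zero {E : Type*} [NormedAddCommGroup E]
    [InnerProductSpace ℝ E] [FiniteDimensional ℝ E] {A : Module.End ℝ E} (hA : A.IsSymmetric)
    {r : ℝ[X]} (hr : ∀ i, r.eval (hA.eigenvalues rfl i) = 0) : aeval A r = 0 := by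
  refine (hA.eigenvectorBasis rfl).toBasis.ext fun i => ?_
  have h := Module.End.aeval_apply_of_hasEigenvector (p := r)
    (hA.hasEigenvector_eigenvectorBasis rfl i)
  have hi := hr i
  simp only [RCLike.ofReal_real_eq_id, id_eq] at h
  simp [h, hi]

open Polynomial in
/-- A polynomial in a symmetric real operator is symmetric. -/
theorem LinearMap.IsSymmetric.aeval {E : Type*} [NormedAddCommGroup E]
    [InnerProductSpace ℝ E] {A : Module.End ℝ E} (hA : A.IsSymmetric) (p : ℝ[X]) :
    (Polynomial.aeval A p).IsSymmetric := by
  induction p using Polynomial.induction_on' with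
  | add p q hp hq => rw [map_add]; exact hp.add hq
  | monomial n a =>
    rw [aeval_monomial, Algebra.algebraMap_eq_smul_one, smul_mul_assoc, one_mul]
    exact (hA.pow n).smul (by simp)

open Polynomial in
theorem Commute.aeval_right {R S : Type*} [CommSemiring R] [Semiring S] [Algebra R S] {a b : S}
    (h : Commute b a) (p : R[X]) : Commute b (aeval a p) := by
  induction p using Polynomial.induction_on' with
  | add p q hp hq => rw [map_add]; exact hp.add_right hq
  | monomial n c =>
    rw [aeval_monomial]
    exact (Algebra.commute_algebraMap_right c b).mul_right (h.pow_right n)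

open Polynomial in
/-- An injective symmetric operator `A` has a sign `p(A)`, an involution such that `A * p(A)` is
the square of a polynomial in `A`. -/
theorem LinearMap.IsSymmetric.exists_sign {E : Type*} [NormedAddCommGroup E]
    [InnerProductSpace ℝ E] [FiniteDimensional ℝ E] {A : Module.End ℝ E} (hA : A.IsSymmetric)
    (hinj : ∀ v, A v = 0 → v = 0) :
    ∃ p q : ℝ[X], Polynomial.aeval A p * Polynomial.aeval A p = 1 ∧
      A * Polynomial.aeval A p = Polynomial.aeval A q * Polynomial.aeval A q := by
  classical
  have hne : ∀ i, hA.eigenvalues rfl i ≠ 0 := fun i h0 => by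
    have hv := hA.apply_eigenvectorBasis rfl i
    rw [h0] at hv
    exact (hA.hasEigenvector_eigenvectorBasis rfl i).2 (hinj _ (by simpa using hv))
  let s : Finset ℝ := Finset.univ.image (hA.eigenvalues rfl)
  let L : (ℝ → ℝ) → ℝ[X] := fun f => Lagrange.interpolate s _root_.id f
  have interp : ∀ f i, (L f).eval (hA.eigenvalues rfl i) = f (hA.eigenvalues rfl i) := fun f i =>
    Lagrange.eval_interpolate_at_node (v := _root_.id) f Function.injective_id.injOn
      (Finset.mem_image_of_mem _ (Finset.mem_univ i))
  let p := L fun x => SignType.sign x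
  let q := L fun x => √|x|
  refine ⟨p, q, ?_, ?_⟩
  · have h := hA.aeval_eq_zero (r := p * p - 1) fun i => by
      rw [eval_sub, eval_mul, interp, eval_one]
      rcases (hne i).lt_or_gt with h | h <;> simp [h]
    simpa [sub_eq_zero] using h
  · have h := hA.aeval_eq_zero (r := X * p - q * q) fun i => by
      rw [eval_sub, eval_mul, eval_mul, interp, interp, eval_X, self_mul_sign,
        Real.mul_self_sqrt (abs_nonneg _), sub_self]
    simpa [sub_eq_zero] using h

/-- A compatible complex structure that is isometric for some inner product commutes with a
positive one. -/
theorem exists_positive_commuting_of_isometry {V : Type*} [NormedAddCommGroup V]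
    [InnerProductSpace ℝ V] [FiniteDimensional ℝ V]
    (Ω : V →ₗ[ℝ] V →ₗ[ℝ] ℝ)
    (hΩalt : ∀ v, Ω v v = 0)
    (hΩnondeg : ∀ v, (∀ w, Ω v w = 0) → v = 0)
    (jt : Module.End ℝ V)
    (hjt2 : jt * jt = -1)
    (hjtsymp : ∀ v w, Ω (jt v) (jt w) = Ω v w)
    (hiso : ∀ v w, inner ℝ (jt v) (jt w) = inner ℝ v w) :
    ∃ j : Module.End ℝ V,
      j * j = -1 ∧ (∀ v w, Ω (j v) (j w) = Ω v w) ∧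
      (∀ v, v ≠ 0 → 0 < Ω v (j v)) ∧ j * jt = jt * j := by
  have hjj : ∀ v, jt (jt v) = -v := fun v => by simpa using LinearMap.congr_fun hjt2 v
  have hskew : ∀ v w, Ω v w = -Ω w v := fun v w => by
    have h := hΩalt (v + w)
    simp only [map_add, LinearMap.add_apply, hΩalt] at h
    linarith
  let b := stdOrthonormalBasis ℝ V
  let A : Module.End ℝ V := ∑ i, ((Ω.flip (jt (b i))).smulRight (b i))
  have hA : ∀ v w, inner ℝ (A v) w = Ω v (jt w) := fun v w => by
    conv_rhs => rw [← b.sum_repr' w]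
    simp [A, sum_inner, inner_smul_left, mul_comm]
  have hsymm : A.IsSymmetric := fun v w => by
    rw [hA, real_inner_comm, hA, ← hjtsymp v, hjj, map_neg, hskew, neg_neg]
  have hcomm : Commute jt A := by
    ext v
    refine ext_inner_right ℝ fun w => ?_
    have h : inner ℝ (jt (A v)) w = -inner ℝ (A v) (jt w) := by
      rw [← hiso (A v), hjj, inner_neg_right, neg_neg]
    simp [h, hA, hjj, hjtsymp]
  have hinj : ∀ v, A v = 0 → v = 0 := fun v hv => hΩnondeg v fun w => by
    have h := hA v (jt w)
    rw [hv, inner_zero_left, hjj, map_neg] at h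
    linarith
  obtain ⟨p, q, hp, hq⟩ := hsymm.exists_sign hinj
  have hεsymm := hsymm.aeval p
  have hBsymm := hsymm.aeval q
  have hεA : Commute A (Polynomial.aeval A p) := (Commute.refl A).aeval_right p
  have hεj := hcomm.aeval_right p
  generalize Polynomial.aeval A p = ε at *
  generalize Polynomial.aeval A q = B at *
  have hεε : ∀ v, ε (ε v) = v := fun v => by simpa using LinearMap.congr_fun hp v
  have hAε : ∀ v, A (ε v) = ε (A v) := fun v => by simpa using LinearMap.congr_fun hεA.eq v
  have hAεB : ∀ v, A (ε v) = B (B v) := fun v => by simpa using LinearMap.congr_fun hq v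
  have hjε : ∀ v, jt (ε v) = ε (jt v) := fun v => by simpa using LinearMap.congr_fun hεj.eq v
  refine ⟨jt * ε, ?_, fun v w => ?_, fun v hv => ?_, ?_⟩
  · ext v
    simp [hjε, hεε, hjj]
  · have hΩA : ∀ v w, Ω v w = -inner ℝ (A v) (jt w) := fun v w => by simp [hA, hjj]
    rw [Module.End.mul_apply, Module.End.mul_apply, hjtsymp, hΩA, hΩA, hjε, hAε, hεsymm, hεε]
  · rw [Module.End.mul_apply, ← hA, hsymm, hAεB, ← hBsymm]
    refine real_inner_self_pos.2 fun h => hv ?_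
    have h0 := hinj (ε v) (by rw [hAεB, h, map_zero])
    rw [← hεε v, h0, map_zero]
  · rw [mul_assoc, hεj.eq]

/-- A complex structure on a finite-dimensional real space is isometric for some inner product. -/
theorem exists_invariant_inner {V : Type*} [AddCommGroup V] [Module ℝ V] [FiniteDimensional ℝ V]
    (jt : Module.End ℝ V) (hjt2 : jt * jt = -1) :
    ∃ c : InnerProductSpace.Core ℝ V, ∀ v w, c.inner (jt v) (jt w) = c.inner v w := by
  have hjj : ∀ v, jt (jt v) = -v := fun v => by simpa using LinearMap.congr_fun hjt2 v
  let φ := (Module.finBasis ℝ V).equivFun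
  refine ⟨{ inner := fun v w => φ v ⬝ᵥ φ w + φ (jt v) ⬝ᵥ φ (jt w)
            conj_inner_symm := fun v w => ?_
            re_inner_nonneg := fun v => ?_
            add_left := fun u v w => ?_
            smul_left := fun v w r => ?_
            definite := fun v hv => ?_ }, fun v w => ?_⟩
  · simp [dotProduct_comm]
  · exact add_nonneg (Finset.sum_nonneg fun _ _ => mul_self_nonneg _)
      (Finset.sum_nonneg fun _ _ => mul_self_nonneg _)
  · simp only [map_add, add_dotProduct]
    ring
  · simp only [map_smul, smul_dotProduct, smul_eq_mul, conj_trivial]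
    ring
  · have h1 : φ v ⬝ᵥ φ v + φ (jt v) ⬝ᵥ φ (jt v) = 0 := hv
    have h2 : 0 ≤ φ v ⬝ᵥ φ v := Finset.sum_nonneg fun _ _ => mul_self_nonneg _
    have h3 : 0 ≤ φ (jt v) ⬝ᵥ φ (jt v) := Finset.sum_nonneg fun _ _ => mul_self_nonneg _
    exact φ.map_eq_zero_iff.1 (dotProduct_self_eq_zero.1 (by linarith))
  · change φ (jt v) ⬝ᵥ φ (jt w) + φ (jt (jt v)) ⬝ᵥ φ (jt (jt w)) =
      φ v ⬝ᵥ φ w + φ (jt v) ⬝ᵥ φ (jt w)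
    simp [hjj, add_comm]



/-- For every compatible complex structure `j̃` on `(V,Ω)` there
exists a positive compatible complex structure `j` on `(V,Ω)` commuting with `j̃`. -/
theorem stmt11 {V : Type*} [AddCommGroup V] [Module ℝ V] [FiniteDimensional ℝ V]
    (Ω : V →ₗ[ℝ] V →ₗ[ℝ] ℝ)
    (hΩalt : ∀ v, Ω v v = 0)
    (hΩnondeg : ∀ v, (∀ w, Ω v w = 0) → v = 0)
    (jt : Module.End ℝ V)
    (hjt2 : jt * jt = -1)
    (hjtsymp : ∀ v w, Ω (jt v) (jt w) = Ω v w) :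
    ∃ j : Module.End ℝ V,
      j * j = -1 ∧ (∀ v w, Ω (j v) (j w) = Ω v w) ∧
      (∀ v, v ≠ 0 → 0 < Ω v (j v)) ∧ j * jt = jt * j := by
  obtain ⟨c, hc⟩ := exists_invariant_inner jt hjt2
  let _ : NormedAddCommGroup V := c.toNormedAddCommGroup
  let _ : InnerProductSpace ℝ V := InnerProductSpace.ofCore c.toCore
  exact exists_positive_commuting_of_isometry Ω hΩalt hΩnondeg jt hjt2 hjtsymp hc
end

section
/- Let j̃ be a compatible complex structure on (V,Ω) and j a positive compatible complex structure with j∘j̃ = j̃∘j. Set V₊ = {v ∈ V : j̃v = jv} and V₋ = {v ∈ V : j̃v = −jv}. Then V = V₊ ⊕ V₋; each of V₊, V₋ is stable under both j and j̃; the restriction of Ω to each of V₊, V₋ is nondegenerate (they are symplectic subspaces); and V₊ and V₋ are mutually orthogonal with respect to each of Ω, G_j and G_j̃. -/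
/-- if `j̃` is a compatible complex structure, `j` a positive
compatible complex structure commuting with `j̃`, and
`V₊ = {v : j̃v = jv}`, `V₋ = {v : j̃v = −jv}`, then `V = V₊ ⊕ V₋`,
both subspaces are stable under `j` and `j̃`, the restriction of `Ω` to each
is nondegenerate, and `V₊ ⊥ V₋` for each of `Ω`, `G_j` and `G_j̃`. -/
theorem stmt12 {V : Type*} [AddCommGroup V] [Module ℝ V] [FiniteDimensional ℝ V]
    (Ω : V →ₗ[ℝ] V →ₗ[ℝ] ℝ)
    (hΩalt : ∀ v, Ω v v = 0)
    (hΩnondeg : ∀ v, (∀ w, Ω v w = 0) → v = 0)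
    (jt : Module.End ℝ V)
    (hjt2 : jt * jt = -1)
    (hjtsymp : ∀ v w, Ω (jt v) (jt w) = Ω v w)
    (j : Module.End ℝ V)
    (hj2 : j * j = -1)
    (hjsymp : ∀ v w, Ω (j v) (j w) = Ω v w)
    (hjpos : ∀ v, v ≠ 0 → 0 < Ω v (j v))
    (hcomm : j * jt = jt * j) :
    IsCompl (LinearMap.eqLocus jt j) (LinearMap.eqLocus jt (-j))
    ∧ (∀ v ∈ LinearMap.eqLocus jt j, j v ∈ LinearMap.eqLocus jt j
        ∧ jt v ∈ LinearMap.eqLocus jt j)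
    ∧ (∀ v ∈ LinearMap.eqLocus jt (-j), j v ∈ LinearMap.eqLocus jt (-j)
        ∧ jt v ∈ LinearMap.eqLocus jt (-j))
    ∧ (∀ v ∈ LinearMap.eqLocus jt j,
        (∀ w ∈ LinearMap.eqLocus jt j, Ω v w = 0) → v = 0)
    ∧ (∀ v ∈ LinearMap.eqLocus jt (-j),
        (∀ w ∈ LinearMap.eqLocus jt (-j), Ω v w = 0) → v = 0)
    ∧ (∀ v ∈ LinearMap.eqLocus jt j, ∀ w ∈ LinearMap.eqLocus jt (-j),
        Ω v w = 0 ∧ Ω v (j w) = 0 ∧ Ω v (jt w) = 0) := by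
  have hj (v : V) : j (j v) = -v := by simpa using LinearMap.congr_fun hj2 v
  have hjt (v : V) : jt (jt v) = -v := by simpa using LinearMap.congr_fun hjt2 v
  have hc (v : V) : jt (j v) = j (jt v) := by simpa using (LinearMap.congr_fun hcomm v).symm
  simp only [LinearMap.mem_eqLocus, LinearMap.neg_apply]
  have plus_stable (v : V) (hv : jt v = j v) : jt (j v) = j (j v) := by rw [hc, hv]
  have minus_stable (v : V) (hv : jt v = -j v) : jt (j v) = -j (j v) := by
    rw [hc, hv, map_neg]
  have orth (v w : V) (hv : jt v = j v) (hw : jt w = -j w) : Ω v w = 0 := by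
    have h := hjtsymp v w
    rw [hv, hw, map_neg, hjsymp] at h
    linarith
  have eq_zero (v : V) (h : Ω v (j v) = 0) : v = 0 := by
    by_contra hv
    exact (hjpos v hv).ne' h
  refine ⟨⟨?_, ?_⟩, ?_, ?_, ?_, ?_, ?_⟩
  · rw [Submodule.disjoint_def]
    intro v hv hv'
    simp only [LinearMap.mem_eqLocus, LinearMap.neg_apply] at hv hv'
    exact eq_zero v (orth v (j v) hv (minus_stable v hv'))
  · rw [codisjoint_iff, Submodule.eq_top_iff']
    intro v
    rw [Submodule.mem_sup]
    refine ⟨(1 / 2 : ℝ) • (v - j (jt v)), ?_, (1 / 2 : ℝ) • (v + j (jt v)), ?_, ?_⟩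
    · simp only [LinearMap.mem_eqLocus, map_smul, map_sub, hc, hjt, hj, map_neg]
      congr 1
      abel
    · simp only [LinearMap.mem_eqLocus, LinearMap.neg_apply, map_smul, map_add, hc, hjt, hj,
        map_neg]
      congr 1
      abel
    · module
  · intro v hv
    exact ⟨plus_stable v hv, by rw [hv, plus_stable v hv]⟩
  · intro v hv
    exact ⟨minus_stable v hv, by rw [hv, map_neg, map_neg, minus_stable v hv]⟩
  · intro v hv h
    exact eq_zero v (h _ (plus_stable v hv))
  · intro v hv h
    exact eq_zero v (h _ (minus_stable v hv))
  · intro v hv w hw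
    have h := orth v (j w) hv (minus_stable w hw)
    exact ⟨orth v w hv hw, h, by rw [hw, map_neg, h, neg_zero]⟩
end

section
/- Let j̃ be a compatible complex structure on (V,Ω), j a positive compatible complex structure commuting with j̃, and V₋ = {v ∈ V : j̃v = −jv}. For every g ∈ U(V,Ω,j̃) = {g ∈ Sp(V,Ω) : g∘j̃ = j̃∘g}, the restriction C_g⁻ := C_g|_{V₋} is an invertible j-linear endomorphism of V₋, and Det_j C_g = Det_{j̃}(g) · (Det_j C_g⁻)², where Det_j C_g is the determinant of C_g as a ℂ-linear endomorphism of (V,j), Det_{j̃}(g) the determinant of g as a ℂ-linear endomorphism of (V,j̃), and Det_j C_g⁻ the determinant of C_g⁻ as a ℂ-linear endomorphism of (V₋,j). -/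
/-- The eigenspace `V₋ = {v : j̃v = −jv}` (with `j` = multiplication by `i`). -/
noncomputable def Vminus {V : Type*} [AddCommGroup V] [Module ℂ V]
    (jt : V →ₗ[ℂ] V) : Submodule ℂ V :=
  LinearMap.eqLocus jt (-(Complex.I • (LinearMap.id : V →ₗ[ℂ] V)))

namespace LinearMap

theorem det_id_add_comp_comm {K M N : Type*} [Field K] [AddCommGroup M] [Module K M]
    [FiniteDimensional K M] [AddCommGroup N] [Module K N] [FiniteDimensional K N]
    (f : M →ₗ[K] N) (g : N →ₗ[K] M) :
    LinearMap.det (LinearMap.id + g ∘ₗ f) = LinearMap.det (LinearMap.id + f ∘ₗ g) := by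
  classical
  let b := Module.finBasis K M
  let c := Module.finBasis K N
  rw [← det_toMatrix b, ← det_toMatrix c, map_add, map_add, toMatrix_id, toMatrix_id,
    toMatrix_comp b c b, toMatrix_comp c b c, Matrix.det_one_add_mul_comm]

/-- The determinant of the map which is `f` on the range of the projection `i ∘ p` and the identity
on its kernel. -/
theorem det_one_add_sub_one_mul_proj {K M N : Type*} [Field K] [AddCommGroup M] [Module K M]
    [FiniteDimensional K M] [AddCommGroup N] [Module K N] [FiniteDimensional K N]
    (i : N →ₗ[K] M) (p : M →ₗ[K] N) (hpi : p ∘ₗ i = LinearMap.id) (f : Module.End K M) :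
    LinearMap.det (1 + (f - 1) * (i ∘ₗ p)) = LinearMap.det (p ∘ₗ f ∘ₗ i) := by
  have h : (1 + (f - 1) * (i ∘ₗ p)) = LinearMap.id + ((f - 1) ∘ₗ i) ∘ₗ p := rfl
  rw [h, det_id_add_comp_comm]
  congr 1
  ext x
  have hx : p (i x) = x := congr($hpi x)
  simp [hx]

/-- An `ℝ`-linear map commuting with multiplication by `i`, as a `ℂ`-linear map. -/
def complexOfCommI {E F : Type*} [AddCommGroup E] [Module ℂ E] [AddCommGroup F] [Module ℂ F]
    (f : E →ₗ[ℝ] F) (hf : ∀ x, f (Complex.I • x) = Complex.I • f x) : E →ₗ[ℂ] F where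
  toFun := f
  map_add' := f.map_add
  map_smul' c x := by
    have h (y : E) (r : ℝ) : f ((r : ℂ) • y) = (r : ℂ) • f y := f.map_smul r y
    rw [RingHom.id_apply, ← Complex.re_add_im c, add_smul, add_smul, map_add, mul_smul, mul_smul,
      h, h, hf]

@[simp]
theorem complexOfCommI_apply {E F : Type*} [AddCommGroup E] [Module ℂ E] [AddCommGroup F]
    [Module ℂ F] (f : E →ₗ[ℝ] F) (hf : ∀ x, f (Complex.I • x) = Complex.I • f x) (x : E) :
    complexOfCommI f hf x = f x := rfl

end LinearMap

section Vminus

variable {V : Type*} [AddCommGroup V] [Module ℂ V]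

theorem mem_Vminus {jt : V →ₗ[ℂ] V} {v : V} : v ∈ Vminus jt ↔ jt v = -(Complex.I • v) := Iff.rfl

/-- The projection onto `Vminus jt` along `Vminus (-jt)`. -/
noncomputable def VminusProj (jt : V →ₗ[ℂ] V) (hjt : ∀ v, jt (jt v) = -v) : V →ₗ[ℂ] Vminus jt :=
  LinearMap.codRestrict _ ((2⁻¹ : ℂ) • (LinearMap.id + Complex.I • jt)) fun v ↦ by
    rw [mem_Vminus]
    simp only [LinearMap.smul_apply, LinearMap.add_apply, LinearMap.id_apply, map_smul, map_add,
      hjt]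
    match_scalars
    · ring_nf
      norm_num [Complex.I_sq]
    · ring

variable {jt : V →ₗ[ℂ] V}

theorem coe_VminusProj (hjt : ∀ v, jt (jt v) = -v) (v : V) :
    (VminusProj jt hjt v : V) = (2⁻¹ : ℂ) • (v + Complex.I • jt v) := rfl

theorem VminusProj_coe (hjt : ∀ v, jt (jt v) = -v) (v : Vminus jt) :
    VminusProj jt hjt v = v := by
  apply Subtype.ext
  rw [coe_VminusProj, mem_Vminus.1 v.2]
  match_scalars
  ring_nf
  norm_num [Complex.I_sq]

theorem neg_apply_neg_apply (hjt : ∀ v, jt (jt v) = -v) (v : V) : (-jt) ((-jt) v) = -v := by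
  simp [hjt]

theorem VminusProj_add_VminusProj_neg (hjt : ∀ v, jt (jt v) = -v) (v : V) :
    (VminusProj jt hjt v : V) + VminusProj (-jt) (neg_apply_neg_apply hjt) v = v := by
  rw [coe_VminusProj, coe_VminusProj, LinearMap.neg_apply]
  match_scalars <;> ring

theorem det_eq_det_compression_mul_det_restrict [FiniteDimensional ℂ V]
    (hjt : ∀ v, jt (jt v) = -v) (C : V →ₗ[ℂ] V) (hCjt : ∀ v, C (jt v) = jt (C v))
    (hC : ∀ v ∈ Vminus jt, C v ∈ Vminus jt) :
    LinearMap.det C =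
      LinearMap.det (VminusProj (-jt) (neg_apply_neg_apply hjt) ∘ₗ C ∘ₗ (Vminus (-jt)).subtype) *
        LinearMap.det (C.restrict hC) := by
  have hres : C.restrict hC = VminusProj jt hjt ∘ₗ C ∘ₗ (Vminus jt).subtype := by
    ext v
    have := VminusProj_coe hjt ⟨C v, hC v v.2⟩
    exact congr(($this : V)).symm
  rw [hres, ← LinearMap.det_one_add_sub_one_mul_proj, ← LinearMap.det_one_add_sub_one_mul_proj,
    ← map_mul]
  · congr 1
    ext v
    simp only [Module.End.mul_apply, LinearMap.add_apply, Module.End.one_apply,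
      LinearMap.sub_apply, LinearMap.comp_apply, Submodule.subtype_apply, coe_VminusProj,
      LinearMap.neg_apply, map_add, map_sub, map_smul, hCjt, hjt, map_neg]
    match_scalars <;> ring_nf <;> norm_num [Complex.I_sq]
  · ext v
    simp [VminusProj_coe hjt]
  · ext v
    simp [VminusProj_coe (neg_apply_neg_apply hjt)]

end Vminus

section Pairing

variable {V : Type*} [AddCommGroup V] [Module ℂ V] {jt : V →ₗ[ℂ] V} {Ω : V →ₗ[ℝ] V →ₗ[ℝ] ℝ}

theorem apply_eq_zero_of_mem_Vminus_neg (hj : ∀ v w, Ω (Complex.I • v) (Complex.I • w) = Ω v w)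
    (hjt : ∀ v w, Ω (jt v) (jt w) = Ω v w) {x u : V} (hx : x ∈ Vminus (-jt))
    (hu : u ∈ Vminus jt) : Ω x u = 0 := by
  have hx' : jt x = Complex.I • x := neg_injective (mem_Vminus.1 hx)
  have h := hjt x u
  rw [hx', mem_Vminus.1 hu, map_neg, hj] at h
  linarith

theorem apply_VminusProj (hj : ∀ v w, Ω (Complex.I • v) (Complex.I • w) = Ω v w)
    (hjt2 : ∀ v, jt (jt v) = -v) (hjt : ∀ v w, Ω (jt v) (jt w) = Ω v w) (x : V) {u : V}
    (hu : u ∈ Vminus jt) : Ω (VminusProj jt hjt2 x) u = Ω x u := by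
  conv_rhs => rw [← VminusProj_add_VminusProj_neg hjt2 x]
  rw [map_add, LinearMap.add_apply, apply_eq_zero_of_mem_Vminus_neg hj hjt (Subtype.prop _) hu,
    add_zero]

variable {W : Type*} [AddCommGroup W] [Module ℂ W]

/-- For `e` intertwining `jt` and `i`, the pairing `(w, v) ↦ -Ω(v, jt e⁻¹w) - i Ω(v, e⁻¹w)`. -/
noncomputable def dualPairing (hjt2 : ∀ v, jt (jt v) = -v) (hjt : ∀ v w, Ω (jt v) (jt w) = Ω v w)
    (e : V ≃ₗ[ℝ] W) (he : ∀ w, e.symm (Complex.I • w) = jt (e.symm w)) :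
    W →ₗ[ℂ] Module.Dual ℂ (Vminus jt) :=
  LinearMap.complexOfCommI
    { toFun := fun w ↦ LinearMap.complexOfCommI
        { toFun := fun v ↦ -(Ω v (jt (e.symm w)) : ℂ) - Complex.I * Ω v (e.symm w)
          map_add' := fun v v' ↦ by
            simp only [Submodule.coe_add, map_add, LinearMap.add_apply, Complex.ofReal_add]
            ring
          map_smul' := fun r v ↦ by
            have h : ((r • v : Vminus jt) : V) = r • (v : V) := rfl
            simp only [h, map_smul, LinearMap.smul_apply, smul_eq_mul, Complex.ofReal_mul,
              RingHom.id_apply, Complex.real_smul]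
            ring }
        fun v ↦ by
          have h : Complex.I • (v : V) = -jt v := by rw [mem_Vminus.1 v.2, neg_neg]
          have h1 (u : V) : Ω (jt v) u = -Ω v (jt u) := by
            rw [← hjt v, hjt2, map_neg, neg_neg]
          simp only [LinearMap.coe_mk, AddHom.coe_mk, Submodule.coe_smul, h, map_neg,
            LinearMap.neg_apply, h1, hjt2, Complex.ofReal_neg, smul_eq_mul]
          linear_combination (Ω v (e.symm w) : ℂ) * Complex.I_mul_I
      map_add' := fun w w' ↦ by
        ext v
        simp only [map_add, LinearMap.add_apply, Complex.ofReal_add,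
          LinearMap.complexOfCommI_apply, LinearMap.coe_mk, AddHom.coe_mk]
        ring
      map_smul' := fun r w ↦ by
        ext v
        have h (u : V) : jt (r • u) = r • jt u := jt.map_smul_of_tower r u
        simp only [h, map_smul, LinearMap.smul_apply, smul_eq_mul, Complex.ofReal_mul,
          RingHom.id_apply, Complex.real_smul, LinearMap.complexOfCommI_apply, LinearMap.coe_mk,
          AddHom.coe_mk]
        ring }
    fun w ↦ by
      ext v
      simp only [LinearMap.coe_mk, AddHom.coe_mk, LinearMap.complexOfCommI_apply, he, hjt2, map_neg,
        Complex.ofReal_neg, LinearMap.smul_apply, smul_eq_mul]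
      linear_combination (Ω v (e.symm w) : ℂ) * Complex.I_mul_I

variable (hjt2 : ∀ v, jt (jt v) = -v) (hjt : ∀ v w, Ω (jt v) (jt w) = Ω v w)
  (e : V ≃ₗ[ℝ] W) (he : ∀ w, e.symm (Complex.I • w) = jt (e.symm w))

theorem dualPairing_apply (w : W) (v : Vminus jt) :
    dualPairing hjt2 hjt e he w v =
      -(Ω v (jt (e.symm w)) : ℂ) - Complex.I * Ω v (e.symm w) := rfl

theorem eq_zero_of_dualPairing_eq_zero (hpos : ∀ v, v ≠ 0 → 0 < Ω v (Complex.I • v)) {u : V}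
    (hu : u ∈ Vminus jt) (h : dualPairing hjt2 hjt e he (e u) = 0) : u = 0 := by
  by_contra hne
  have h1 : dualPairing hjt2 hjt e he (e u) ⟨u, hu⟩ = 0 := by rw [h]; rfl
  have h2 := congr(Complex.re $h1)
  have h3 := hpos u hne
  simp [dualPairing_apply, mem_Vminus.1 hu] at h2
  linarith

theorem dualPairing_surjective [FiniteDimensional ℂ V]
    (hpos : ∀ v, v ≠ 0 → 0 < Ω v (Complex.I • v)) :
    Function.Surjective (dualPairing hjt2 hjt e he) := by
  let f : Vminus jt →ₗ[ℝ] Module.Dual ℂ (Vminus jt) :=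
    (dualPairing hjt2 hjt e he).restrictScalars ℝ ∘ₗ e.toLinearMap ∘ₗ
      (Vminus jt).subtype.restrictScalars ℝ
  have hinj : Function.Injective f := by
    rw [injective_iff_map_eq_zero]
    intro u hu
    exact Subtype.ext (eq_zero_of_dualPairing_eq_zero hjt2 hjt e he hpos u.2 hu)
  have : FiniteDimensional ℝ (Vminus jt) := FiniteDimensional.complexToReal _
  have : FiniteDimensional ℝ (Module.Dual ℂ (Vminus jt)) := FiniteDimensional.complexToReal _
  have hsurj : Function.Surjective f := by
    refine (LinearMap.injective_iff_surjective_of_finrank_eq_finrank ?_).1 hinj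
    rw [finrank_real_of_complex, finrank_real_of_complex, Subspace.dual_finrank_eq]
  intro φ
  obtain ⟨u, hu⟩ := hsurj φ
  exact ⟨_, hu⟩

theorem dualPairing_proj (hj : ∀ v w, Ω (Complex.I • v) (Complex.I • w) = Ω v w) (w : W) :
    dualPairing hjt2 hjt e he (e (VminusProj jt hjt2 (e.symm w))) =
      dualPairing hjt2 hjt e he w := by
  have hanti (x y : V) : Ω (jt x) y = -Ω x (jt y) := by
    rw [← hjt x, hjt2, map_neg, neg_neg]
  have hI (x y : V) : Ω (Complex.I • x) y = -Ω x (Complex.I • y) := by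
    rw [← hj x, smul_smul, Complex.I_mul_I, neg_one_smul, map_neg, neg_neg]
  have key (v : Vminus jt) (y : V) : Ω v (VminusProj jt hjt2 y) = Ω v y := by
    have h : (2⁻¹ : ℂ) • (y + Complex.I • jt y) = (2⁻¹ : ℝ) • (y + Complex.I • jt y) := by
      rw [← Complex.coe_smul]
      norm_num
    have h2 : Ω v (Complex.I • jt y) = Ω v y := by
      have := hI v (jt y)
      rw [← neg_eq_iff_eq_neg, ← LinearMap.neg_apply, ← map_neg, ← mem_Vminus.1 v.2, hjt] at this
      exact this.symm
    rw [coe_VminusProj, h, map_smul, map_add, h2, smul_eq_mul]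
    ring
  ext v
  have hv (y : V) : Ω v (jt y) = Ω (Complex.I • (v : V)) y := by
    rw [← neg_eq_iff_eq_neg.2 (mem_Vminus.1 v.2), map_neg, LinearMap.neg_apply, hanti, neg_neg]
  rw [dualPairing_apply, dualPairing_apply, LinearEquiv.symm_apply_apply, key, hv, hv]
  exact congr(-(($(key (Complex.I • v) (e.symm w)) : ℝ) : ℂ) - _)

end Pairing

/-- for `g ∈ U(V,Ω,j̃)`, the restriction `C_g⁻ = C_g|_{V₋}` is an
invertible `j`-linear endomorphism of `V₋`, and
`Det_j C_g = Det_j̃(g) · (Det_j C_g⁻)²`.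
Here the complex structure `j` is multiplication by `i` on the complex vector
space `V`, `C` is the `ℂ`-linear endomorphism `C_g = ½(g − j∘g∘j)`, and
`Det_j̃ g` is realised as the determinant of the `ℂ`-linear map `gW`
corresponding to `g` on an auxiliary complex vector space `W` on which `j̃`
becomes multiplication by `i` via the identification `e`. -/
theorem stmt14 {V : Type*} [AddCommGroup V] [Module ℂ V] [FiniteDimensional ℂ V]
    (Ω : V →ₗ[ℝ] V →ₗ[ℝ] ℝ)
    (hΩalt : ∀ v, Ω v v = 0)
    (hΩnondeg : ∀ v, (∀ w, Ω v w = 0) → v = 0)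
    -- j := multiplication by i is a positive compatible complex structure
    (hjsymp : ∀ v w, Ω (Complex.I • v) (Complex.I • w) = Ω v w)
    (hjpos : ∀ v, v ≠ 0 → 0 < Ω v (Complex.I • v))
    -- j̃ : a compatible complex structure commuting with j (hence ℂ-linear)
    (jt : V →ₗ[ℂ] V)
    (hjt2 : ∀ v, jt (jt v) = -v)
    (hjtsymp : ∀ v w, Ω (jt v) (jt w) = Ω v w)
    -- g in the pseudo-unitary group U(V,Ω,j̃)
    (g : V →ₗ[ℝ] V)
    (hgbij : Function.Bijective g)
    (hgsymp : ∀ v w, Ω (g v) (g w) = Ω v w)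
    (hgjt : ∀ v, g (jt v) = jt (g v))
    -- C : the ℂ-linear endomorphism C_g = ½(g − j∘g∘j)
    (C : V →ₗ[ℂ] V)
    (hC : ∀ v, C v = (2⁻¹ : ℝ) • (g v - Complex.I • g (Complex.I • v)))
    (hCV : ∀ v ∈ Vminus jt, C v ∈ Vminus jt)
    -- (W, e, gW) : a realisation of (V, j̃) as a complex vector space,
    -- gW being g viewed as a ℂ-linear endomorphism of (V, j̃)
    (W : Type*) [AddCommGroup W] [Module ℂ W] [FiniteDimensional ℂ W]
    (e : V ≃ₗ[ℝ] W)
    (he : ∀ v, e (jt v) = Complex.I • e v)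
    (gW : W →ₗ[ℂ] W)
    (hgW : ∀ v, gW (e v) = e (g v)) :
    Function.Bijective (C.restrict hCV)
    ∧ LinearMap.det C = LinearMap.det gW * (LinearMap.det (C.restrict hCV)) ^ 2 := by
  have hCproj (v : V) (hv : v ∈ Vminus jt) : C v = VminusProj jt hjt2 (g v) := by
    have hv' : Complex.I • v = -jt v := by rw [mem_Vminus.1 hv, neg_neg]
    rw [hC, hv', map_neg, hgjt, smul_neg, sub_neg_eq_add, coe_VminusProj, ← Complex.coe_smul]
    norm_num
  have hCproj' (v : V) (hv : v ∈ Vminus (-jt)) :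
      C v = VminusProj (-jt) (neg_apply_neg_apply hjt2) (g v) := by
    have hv' : Complex.I • v = jt v := (neg_injective (mem_Vminus.1 hv)).symm
    rw [hC, hv', hgjt, coe_VminusProj, ← Complex.coe_smul, LinearMap.neg_apply, smul_neg,
      ← sub_eq_add_neg]
    norm_num
  have hCjt (v : V) : C (jt v) = jt (C v) := by
    rw [hC, hC, jt.map_smul_of_tower, map_sub, jt.map_smul, ← jt.map_smul Complex.I v,
      ← hgjt, ← hgjt]
  have hes (w : W) : e.symm (Complex.I • w) = jt (e.symm w) := by
    rw [LinearEquiv.symm_apply_eq, he, LinearEquiv.apply_symm_apply]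
  constructor
  · have hinj : Function.Injective (C.restrict hCV) := by
      rw [injective_iff_map_eq_zero]
      intro v hv
      have hv0 : C v = 0 := congr(($hv : V))
      rw [hCproj v v.2] at hv0
      by_contra hne
      have hne' : (v : V) ≠ 0 := fun h ↦ hne (Subtype.ext h)
      have hgv : g v ∈ Vminus (-jt) := by
        have := VminusProj_add_VminusProj_neg hjt2 (g v)
        rw [hv0, zero_add] at this
        rw [← this]
        exact Subtype.prop _
      have h1 := hgsymp v (jt v)
      have h2 : jt (g v) = Complex.I • g v := neg_injective (mem_Vminus.1 hgv)
      rw [hgjt, h2, mem_Vminus.1 v.2, map_neg] at h1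
      have h3 := hjpos v hne'
      have h4 := hjpos (g v) fun h ↦ hne' (hgbij.1 (h.trans (map_zero g).symm))
      linarith
    exact ⟨hinj, LinearMap.injective_iff_surjective.1 hinj⟩
  have hgWbij : Function.Bijective gW := by
    have h : ⇑gW = e ∘ g ∘ e.symm := by
      ext w
      rw [Function.comp_apply, Function.comp_apply, ← hgW, LinearEquiv.apply_symm_apply]
    rw [h]
    exact e.bijective.comp (hgbij.comp e.symm.bijective)
  have hgWs (w : W) : e.symm (gW w) = g (e.symm w) := by
    rw [LinearEquiv.symm_apply_eq, ← hgW, LinearEquiv.apply_symm_apply]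
  let G := LinearEquiv.ofBijective gW hgWbij
  let G' : Module.End ℂ W := G.symm.toLinearMap
  have hG' (w : W) : gW (G' w) = w := G.apply_symm_apply w
  let ip : Vminus (-jt) →ₗ[ℂ] W := LinearMap.complexOfCommI
    (e.toLinearMap ∘ₗ (Vminus (-jt)).subtype.restrictScalars ℝ) fun v ↦ by
      have hv : jt v = Complex.I • v := neg_injective (mem_Vminus.1 v.2)
      simp [← hv, he]
  let pp : W →ₗ[ℂ] Vminus (-jt) := LinearMap.complexOfCommI
    ((VminusProj (-jt) (neg_apply_neg_apply hjt2)).restrictScalars ℝ ∘ₗ e.symm.toLinearMap)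
    fun w ↦ by
      apply Subtype.ext
      simp only [LinearMap.comp_apply, LinearEquiv.coe_coe, LinearMap.restrictScalars_apply,
        Submodule.coe_smul, coe_VminusProj, hes, LinearMap.neg_apply, hjt2]
      match_scalars <;> ring_nf <;> norm_num [Complex.I_sq]
  let P : Module.End ℂ W := LinearMap.complexOfCommI
    (e.toLinearMap ∘ₗ (Vminus jt).subtype.restrictScalars ℝ ∘ₗ
      (VminusProj jt hjt2).restrictScalars ℝ ∘ₗ e.symm.toLinearMap) fun w ↦ by
      simp only [LinearMap.comp_apply, LinearEquiv.coe_coe, LinearMap.restrictScalars_apply,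
        Submodule.subtype_apply, hes, ← he]
      congr 1
      simp only [coe_VminusProj, map_smul, map_add]
  have hP (w : W) : P w = e (VminusProj jt hjt2 (e.symm w)) := rfl
  let pm := dualPairing hjt2 hjtsymp e hes
  have hpmP (w : W) : pm (P w) = pm w := dualPairing_proj hjt2 hjtsymp e hes hjsymp w
  obtain ⟨s, hs⟩ := pm.exists_rightInverse_of_surjective
    (LinearMap.range_eq_top.2 (dualPairing_surjective hjt2 hjtsymp e hes hjpos))
  let im := P ∘ₗ s
  have hpi : pm ∘ₗ im = LinearMap.id := by
    ext1 φ
    exact (hpmP _).trans congr($hs φ)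
  have hip : im ∘ₗ pm = P := by
    ext w
    have h : pm (P (s (pm w) - w)) = 0 := by
      rw [hpmP, map_sub, sub_eq_zero]
      exact congr($hs (pm w))
    have h0 := eq_zero_of_dualPairing_eq_zero hjt2 hjtsymp e hes hjpos (Subtype.prop _) h
    have : P (s (pm w) - w) = 0 := (congrArg e h0).trans (map_zero e)
    rwa [map_sub, sub_eq_zero] at this
  have hplus : ip ∘ₗ pp = 1 - P := by
    rw [eq_sub_iff_add_eq']
    ext w
    change e (VminusProj jt hjt2 (e.symm w)) +
      e (VminusProj (-jt) (neg_apply_neg_apply hjt2) (e.symm w)) = w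
    rw [← map_add, VminusProj_add_VminusProj_neg, LinearEquiv.apply_symm_apply]
  have hpip : pp ∘ₗ ip = LinearMap.id := by
    ext1 v
    change VminusProj (-jt) (neg_apply_neg_apply hjt2) (e.symm (e v)) = v
    rw [LinearEquiv.symm_apply_apply, VminusProj_coe]
  have hmul : gW * G' = 1 := LinearMap.ext hG'
  have hA : VminusProj (-jt) (neg_apply_neg_apply hjt2) ∘ₗ C ∘ₗ (Vminus (-jt)).subtype =
      pp ∘ₗ gW ∘ₗ ip := by
    ext1 v
    change VminusProj (-jt) (neg_apply_neg_apply hjt2) (C v) =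
      VminusProj (-jt) (neg_apply_neg_apply hjt2) (e.symm (gW (e v)))
    rw [hgWs, LinearEquiv.symm_apply_apply, hCproj' v v.2, VminusProj_coe]
  have hD : pm ∘ₗ G' ∘ₗ im = (C.restrict hCV).dualMap := by
    ext φ v
    have hφ : φ = pm (im φ) := congr($hpi φ).symm
    rw [LinearMap.dualMap_apply]
    conv_rhs => rw [hφ]
    change pm (G' (im φ)) v = _
    have hmem : e.symm (im φ) ∈ Vminus jt := by
      change e.symm (e _) ∈ _
      rw [LinearEquiv.symm_apply_apply]
      exact Subtype.prop _
    have hjmem : jt (e.symm (im φ)) ∈ Vminus jt := by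
      rw [mem_Vminus.1 hmem]
      exact neg_mem (Submodule.smul_mem _ _ hmem)
    have hg : e.symm (im φ) = g (e.symm (G' (im φ))) := by rw [← hgWs, hG']
    rw [dualPairing_apply, dualPairing_apply, LinearMap.coe_restrict_apply, hCproj v v.2,
      apply_VminusProj hjsymp hjt2 hjtsymp _ hmem, apply_VminusProj hjsymp hjt2 hjtsymp _ hjmem,
      hg, ← hgjt, hgsymp, hgsymp]
  have hdet : LinearMap.det (pp ∘ₗ gW ∘ₗ ip) =
      LinearMap.det gW * LinearMap.det (C.restrict hCV) := by
    rw [← LinearMap.det_dualMap (C.restrict hCV), ← hD,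
      ← LinearMap.det_one_add_sub_one_mul_proj ip pp hpip,
      ← LinearMap.det_one_add_sub_one_mul_proj im pm hpi, ← map_mul, hplus, hip]
    congr 1
    rw [mul_add, ← mul_assoc, mul_sub gW, hmul]
    noncomm_ring
  rw [det_eq_det_compression_mul_det_restrict hjt2 C hCjt hCV, hA, hdet]
  ring
end

section
/- Let F ⊂ V be a real Lagrangian subspace and j a positive compatible complex structure on (V,Ω). Then jF is also Lagrangian, F and jF are orthogonal for G_j, and V = F ⊕ jF. Moreover, an element g ∈ Sp(V,Ω) satisfies g(F) ⊆ F if and only if there exist A ∈ GL(F) and an endomorphism S of F symmetric with respect to G_j|_F such that g(v + jw) = Av + ASw + j(Aᵀ)⁻¹w for all v,w ∈ F, where ᵀ denotes transpose with respect to G_j|_F; in that case A = g|_F and S are uniquely determined by g. -/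
/-- The triangular description of an element of `Sp(V,Ω,F)` relative to
`V = F ⊕ jF`:  `g(v + jw) = Av + ASw + j(Aᵀ)⁻¹w` where `A ∈ GL(F)`, `S` is
symmetric for `G_j|_F`, and `A' = (Aᵀ)⁻¹` is characterised by
`G_j(Av, A'w) = G_j(v,w)`. -/
def IsTriangular {V : Type*} [AddCommGroup V] [Module ℝ V]
    (Ω : V →ₗ[ℝ] V →ₗ[ℝ] ℝ) (j : Module.End ℝ V) (F : Submodule ℝ V)
    (g : Module.End ℝ V) (A A' S : Module.End ℝ ↥F) : Prop :=
  Function.Bijective A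
  ∧ (∀ v w : ↥F, Ω (A v : V) (j (A' w : V)) = Ω (v : V) (j (w : V)))
  ∧ (∀ v w : ↥F, Ω (S v : V) (j (w : V)) = Ω (v : V) (j (S w : V)))
  ∧ (∀ v w : ↥F, g ((v : V) + j (w : V))
      = (A v : V) + (A (S w) : V) + j (A' w : V))

section Lagrangian

variable {V : Type*} [AddCommGroup V] [Module ℝ V]
  {Ω : V →ₗ[ℝ] V →ₗ[ℝ] ℝ} {j g : Module.End ℝ V} {F : Submodule ℝ V}

/-- The map `(v, w) ↦ v + jw` from `F × F` to `V`. -/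
def sumComplexStructure (j : Module.End ℝ V) (F : Submodule ℝ V) : (↥F × ↥F) →ₗ[ℝ] V :=
  F.subtype.coprod (j ∘ₗ F.subtype)

@[simp]
theorem sumComplexStructure_apply (x : ↥F × ↥F) :
    sumComplexStructure j F x = (x.1 : V) + j (x.2 : V) := rfl

theorem apply_apply_of_mul_self (hj2 : j * j = -1) (v : V) : j (j v) = -v := by
  simpa using LinearMap.congr_fun hj2 v

theorem injective_of_mul_self (hj2 : j * j = -1) : Function.Injective j := fun v w h => by
  have := congrArg j h
  simpa [apply_apply_of_mul_self hj2] using this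

theorem eq_zero_of_apply_mem (hjpos : ∀ v, v ≠ 0 → 0 < Ω v (j v))
    (hFiso : ∀ v ∈ F, ∀ w ∈ F, Ω v w = 0) {w : V} (hw : w ∈ F) (hjw : j w ∈ F) : w = 0 := by
  by_contra h
  exact (hjpos w h).ne' (hFiso w hw _ hjw)

theorem sumComplexStructure_injective (hjpos : ∀ v, v ≠ 0 → 0 < Ω v (j v))
    (hFiso : ∀ v ∈ F, ∀ w ∈ F, Ω v w = 0) :
    Function.Injective (sumComplexStructure j F) := by
  rw [injective_iff_map_eq_zero]
  rintro ⟨v, w⟩ h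
  simp only [sumComplexStructure_apply] at h
  have hw : (w : V) = 0 := eq_zero_of_apply_mem hjpos hFiso w.2 <| by
    rw [← neg_eq_of_add_eq_zero_right h]
    exact F.neg_mem v.2
  have hv : (v : V) = 0 := by simpa [hw] using h
  ext <;> simp [hv, hw]

theorem IsTriangular.coe_apply {A A' S : Module.End ℝ ↥F} (h : IsTriangular Ω j F g A A' S)
    (v : ↥F) : (A v : V) = g v := by
  simpa using (h.2.2.2 v 0).symm

theorem IsTriangular.unique (hjpos : ∀ v, v ≠ 0 → 0 < Ω v (j v))
    (hFiso : ∀ v ∈ F, ∀ w ∈ F, Ω v w = 0)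
    {A₁ A₁' S₁ A₂ A₂' S₂ : Module.End ℝ ↥F}
    (h₁ : IsTriangular Ω j F g A₁ A₁' S₁) (h₂ : IsTriangular Ω j F g A₂ A₂' S₂) :
    A₁ = A₂ ∧ A₁' = A₂' ∧ S₁ = S₂ := by
  obtain rfl : A₁ = A₂ := by
    ext v
    rw [h₁.coe_apply, h₂.coe_apply]
  have key (w : ↥F) : (A₁ (S₁ w), A₁' w) = (A₁ (S₂ w), A₂' w) := by
    apply sumComplexStructure_injective hjpos hFiso
    have e₁ := h₁.2.2.2 0 w
    have e₂ := h₂.2.2.2 0 w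
    simp only [map_zero, ZeroMemClass.coe_zero, zero_add] at e₁ e₂
    exact e₁.symm.trans e₂
  refine ⟨rfl, LinearMap.ext fun w => (Prod.ext_iff.1 (key w)).2,
    LinearMap.ext fun w => h₁.1.1 (Prod.ext_iff.1 (key w)).1⟩

theorem exists_isTriangular [FiniteDimensional ℝ V] (hΩalt : ∀ v, Ω v v = 0)
    (hj2 : j * j = -1) (hjsymp : ∀ v w, Ω (j v) (j w) = Ω v w)
    (hFiso : ∀ v ∈ F, ∀ w ∈ F, Ω v w = 0)
    (hbij : Function.Bijective (sumComplexStructure j F))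
    (hginj : Function.Injective g) (hg : ∀ v w, Ω (g v) (g w) = Ω v w)
    (hgF : ∀ v ∈ F, g v ∈ F) :
    ∃ A A' S : Module.End ℝ ↥F, IsTriangular Ω j F g A A' S := by
  have hneg (v w : V) : -Ω v w = Ω w v := LinearMap.IsAlt.neg hΩalt v w
  have hjj := apply_apply_of_mul_self hj2
  have hAinj : Function.Injective (g.restrict hgF) := fun v w h =>
    Subtype.ext <| hginj <| congrArg Subtype.val h
  let A : ↥F ≃ₗ[ℝ] ↥F := LinearEquiv.ofInjectiveEndo (g.restrict hgF) hAinj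
  have hA (v : ↥F) : (A v : V) = g v := rfl
  let e : (↥F × ↥F) ≃ₗ[ℝ] V := LinearEquiv.ofBijective _ hbij
  let T : ↥F →ₗ[ℝ] ↥F × ↥F := e.symm.toLinearMap ∘ₗ g ∘ₗ j ∘ₗ F.subtype
  let A' : Module.End ℝ ↥F := LinearMap.snd ℝ _ _ ∘ₗ T
  let S : Module.End ℝ ↥F := A.symm.toLinearMap ∘ₗ LinearMap.fst ℝ _ _ ∘ₗ T
  have hgj (w : ↥F) : g (j w) = A (S w) + j (A' w) := by
    have h : e (T w) = g (j w) := e.apply_symm_apply _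
    have hS : A (S w) = (T w).1 := A.apply_symm_apply _
    rw [hS]
    exact h.symm
  have hAA' (v w : ↥F) : Ω (A v : V) (j (A' w : V)) = Ω (v : V) (j (w : V)) := by
    rw [← hg v, hgj, map_add, ← hA, hFiso _ (A v).2 _ (A (S w)).2, zero_add]
  refine ⟨A, A', S, A.bijective, hAA', fun v w => ?_, fun v w => ?_⟩
  · have h := hg (j v) (j w)
    simp only [hgj, map_add, LinearMap.add_apply, hjsymp] at h
    rw [hFiso _ (A (S v)).2 _ (A (S w)).2, hFiso _ (A' v).2 _ (A' w).2, hFiso _ v.2 _ w.2,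
      ← hneg _ (j (A' v : V)), hAA', hAA', ← hjsymp (S w), hjj, map_neg, hneg] at h
    linarith
  · rw [map_add, hgj, ← add_assoc]
    rfl

end Lagrangian

/-- for a real Lagrangian `F` and a positive compatible complex
structure `j`:  `jF` is Lagrangian, `F ⊥ jF` for `G_j`, `V = F ⊕ jF`; and
`g ∈ Sp(V,Ω)` stabilises `F` iff it admits a (unique) triangular description,
in which case `A = g|_F`. -/
theorem stmt16 {V : Type*} [AddCommGroup V] [Module ℝ V] [FiniteDimensional ℝ V]
    (Ω : V →ₗ[ℝ] V →ₗ[ℝ] ℝ)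
    (hΩalt : ∀ v, Ω v v = 0)
    (hΩnondeg : ∀ v, (∀ w, Ω v w = 0) → v = 0)
    (j : Module.End ℝ V)
    (hj2 : j * j = -1)
    (hjsymp : ∀ v w, Ω (j v) (j w) = Ω v w)
    (hjpos : ∀ v, v ≠ 0 → 0 < Ω v (j v))
    (F : Submodule ℝ V)
    (hFiso : ∀ v ∈ F, ∀ w ∈ F, Ω v w = 0)
    (hFdim : Module.finrank ℝ V = 2 * Module.finrank ℝ ↥F) :
    -- jF is Lagrangian
    ((∀ x ∈ F.map (j : V →ₗ[ℝ] V), ∀ y ∈ F.map (j : V →ₗ[ℝ] V), Ω x y = 0)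
      ∧ Module.finrank ℝ V = 2 * Module.finrank ℝ ↥(F.map (j : V →ₗ[ℝ] V)))
    -- F and jF are G_j-orthogonal
    ∧ (∀ v ∈ F, ∀ x ∈ F.map (j : V →ₗ[ℝ] V), Ω v (j x) = 0)
    -- V = F ⊕ jF
    ∧ IsCompl F (F.map (j : V →ₗ[ℝ] V))
    -- triangular description of the stabiliser of F
    ∧ (∀ g : Module.End ℝ V, Function.Bijective g →
        (∀ v w, Ω (g v) (g w) = Ω v w) →
        ((∀ v ∈ F, g v ∈ F) ↔ ∃ A A' S : Module.End ℝ ↥F,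
            IsTriangular Ω j F g A A' S)
        ∧ (∀ A A' S : Module.End ℝ ↥F, IsTriangular Ω j F g A A' S →
            ∀ v : ↥F, (A v : V) = g v)
        ∧ (∀ A₁ A₁' S₁ A₂ A₂' S₂ : Module.End ℝ ↥F,
            IsTriangular Ω j F g A₁ A₁' S₁ → IsTriangular Ω j F g A₂ A₂' S₂ →
            A₁ = A₂ ∧ A₁' = A₂' ∧ S₁ = S₂)) := by
  have hjj := apply_apply_of_mul_self hj2
  have hjinj := injective_of_mul_self hj2
  have hfin : Module.finrank ℝ ↥(F.map (j : V →ₗ[ℝ] V)) = Module.finrank ℝ ↥F :=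
    (Submodule.equivMapOfInjective j hjinj F).finrank_eq.symm
  have hdisj : Disjoint F (F.map (j : V →ₗ[ℝ] V)) := by
    rw [Submodule.disjoint_def]
    rintro _ hjw ⟨w, hw, rfl⟩
    rw [eq_zero_of_apply_mem hjpos hFiso hw hjw, map_zero]
  have hinj := sumComplexStructure_injective hjpos hFiso
  have hbij : Function.Bijective (sumComplexStructure j F) :=
    ⟨hinj, (LinearMap.injective_iff_surjective_of_finrank_eq_finrank
      (by rw [Module.finrank_prod, hFdim, two_mul])).1 hinj⟩
  refine ⟨⟨?_, hfin ▸ hFdim⟩, ?_, ⟨hdisj, ?_⟩, fun g hgbij hg => ⟨⟨?_, ?_⟩, ?_, ?_⟩⟩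
  · rintro _ ⟨v, hv, rfl⟩ _ ⟨w, hw, rfl⟩
    rw [hjsymp, hFiso v hv w hw]
  · rintro v hv _ ⟨w, hw, rfl⟩
    rw [hjj, map_neg, hFiso v hv w hw, neg_zero]
  · rw [codisjoint_iff]
    exact Submodule.eq_top_of_disjoint _ _ (by rw [hfin, hFdim, two_mul]) hdisj
  · exact exists_isTriangular hΩalt hj2 hjsymp hFiso hbij hgbij.1 hg
  · rintro ⟨A, A', S, h⟩ v hv
    rw [← h.coe_apply ⟨v, hv⟩]
    exact (A ⟨v, hv⟩).2
  · exact fun A A' S h => h.coe_apply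
  · exact fun _ _ _ _ _ _ h₁ h₂ => h₁.unique hjpos hFiso h₂
end

section
/- Let F ⊂ V be a real Lagrangian subspace, j a positive compatible complex structure, and identify the complex vector space (V,j) with the complexification F^ℂ via v + jw ↦ v + iw (v,w ∈ F). For g ∈ Sp(V,Ω) with g(F) ⊆ F, written as g(v+jw) = A_g v + A_g S_g w + j(A_gᵀ)⁻¹w with A_g ∈ GL(F), S_g symmetric with respect to G_j|_F, the operator C_g = ½(g − jgj) corresponds under this identification to the ℂ-linear endomorphism A_g∘(½(I_F + (A_gᵀA_g)⁻¹ − iS_g)) of F^ℂ; consequently Det_j(C_g) = Det_F(A_g) · Det_{F^ℂ}(½(I_F + (A_gᵀA_g)⁻¹ − iS_g)), and the endomorphism ½(I_F + (A_gᵀA_g)⁻¹ − iS_g) of F^ℂ has positive-definite Hermitian real part with respect to the Hermitian extension of G_j|_F to F^ℂ. -/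
open scoped TensorProduct

/-- The endomorphism `½(I_F + (AᵀA)⁻¹ − iS)` of `F^ℂ`, written using
`(AᵀA)⁻¹ = A⁻¹∘(Aᵀ)⁻¹ = A⁻¹∘A'`. -/
noncomputable def MHalf {F : Type*} [AddCommGroup F] [Module ℝ F]
    (A A' S : Module.End ℝ F) : Module.End ℂ (ℂ ⊗[ℝ] F) :=
  (1/2 : ℂ) • ((LinearMap.id : ℂ ⊗[ℝ] F →ₗ[ℂ] ℂ ⊗[ℝ] F)
    + LinearMap.baseChange ℂ (Ring.inverse A * A')
    - Complex.I • LinearMap.baseChange ℂ S)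

/-- Every element of the complexification of `F` has the form `v + iw`. -/
theorem exists_one_tmul_add_I_tmul {F : Type*} [AddCommGroup F] [Module ℝ F]
    (ξ : ℂ ⊗[ℝ] F) :
    ∃ v w : F, ξ = (1 : ℂ) ⊗ₜ[ℝ] v + Complex.I ⊗ₜ[ℝ] w := by
  induction ξ with
  | zero => exact ⟨0, 0, by simp⟩
  | tmul z x =>
    refine ⟨z.re • x, z.im • x, ?_⟩
    rw [← TensorProduct.smul_tmul, ← TensorProduct.smul_tmul, ← TensorProduct.add_tmul]
    congr 1
    apply Complex.ext <;> simp
  | add a b ha hb =>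
    obtain ⟨v, w, rfl⟩ := ha
    obtain ⟨v', w', rfl⟩ := hb
    refine ⟨v + v', w + w', ?_⟩
    rw [TensorProduct.tmul_add, TensorProduct.tmul_add]
    abel

/-- Two complex-linear maps on the complexification of `F` agreeing on `F` are equal. -/
theorem linearMap_ext_one_tmul {F : Type*} [AddCommGroup F] [Module ℝ F]
    {f f' : ℂ ⊗[ℝ] F →ₗ[ℂ] ℂ ⊗[ℝ] F}
    (hf : ∀ v : F, f ((1 : ℂ) ⊗ₜ[ℝ] v) = f' ((1 : ℂ) ⊗ₜ[ℝ] v)) : f = f' := by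
  ext v
  simpa using hf v

theorem I_tmul_eq_smul {F : Type*} [AddCommGroup F] [Module ℝ F] (w : F) :
    Complex.I ⊗ₜ[ℝ] w = Complex.I • ((1 : ℂ) ⊗ₜ[ℝ] w) := by
  simp [TensorProduct.smul_tmul']

theorem ringInverse_apply_of_bijective {F : Type*} [AddCommGroup F] [Module ℝ F]
    {A : Module.End ℝ F} (hA : Function.Bijective A) (x : F) :
    A (Ring.inverse A x) = x := by
  have hu : IsUnit A := (Module.End.isUnit_iff A).2 hA
  rw [← Module.End.mul_apply, Ring.mul_inverse_cancel A hu, Module.End.one_apply]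

/-- Value at `MHalf A A' S ξ` of the Hermitian extension of a real inner product,
expressed through real parts. -/
theorem re_hermitian_MHalf {F : Type*} [AddCommGroup F] [Module ℝ F]
    (G : F → F → ℝ) (h : (ℂ ⊗[ℝ] F) → (ℂ ⊗[ℝ] F) → ℂ)
    (hadd₁ : ∀ x y z, h (x + y) z = h x z + h y z)
    (hadd₂ : ∀ x y z, h x (y + z) = h x y + h x z)
    (hsmul₁ : ∀ (c : ℂ) x y, h (c • x) y = c * h x y)
    (hsmul₂ : ∀ (c : ℂ) x y, h x (c • y) = (starRingEnd ℂ) c * h x y)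
    (hval : ∀ v w : F, h ((1 : ℂ) ⊗ₜ[ℝ] v) ((1 : ℂ) ⊗ₜ[ℝ] w) = ((G v w : ℝ) : ℂ))
    (A A' S : Module.End ℝ F) (hS : ∀ v w, G (S v) w = G (S w) v) (v w : F) :
    (h (MHalf A A' S ((1 : ℂ) ⊗ₜ[ℝ] v + Complex.I ⊗ₜ[ℝ] w))
      ((1 : ℂ) ⊗ₜ[ℝ] v + Complex.I ⊗ₜ[ℝ] w)).re
      = (G v v + G w w + G (Ring.inverse A (A' v)) v + G (Ring.inverse A (A' w)) w) / 2 := by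
  have hsub : ∀ x y z, h (x - y) z = h x z - h y z := by
    intro x y z
    have := hadd₁ (x - y) y z
    rw [sub_add_cancel] at this
    rw [this]; ring
  simp only [MHalf, I_tmul_eq_smul, LinearMap.smul_apply, LinearMap.sub_apply,
    LinearMap.add_apply, LinearMap.id_apply, map_add, map_smul, LinearMap.baseChange_tmul,
    Module.End.mul_apply, hadd₁, hadd₂, hsub, hsmul₁, hsmul₂, hval]
  simp only [Complex.conj_I, hS w v, Complex.mul_re, Complex.mul_im, Complex.add_re,
    Complex.add_im, Complex.sub_re, Complex.sub_im, Complex.neg_re, Complex.neg_im,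
    Complex.I_re, Complex.I_im, Complex.ofReal_re, Complex.ofReal_im]
  norm_num
  ring

/-- under the identification of `(V,j)` with `F^ℂ` via
`v + jw ↦ v + iw`, the operator `C_g` corresponds to
`A_g ∘ (½(I_F + (A_gᵀA_g)⁻¹ − iS_g))`; consequently
`Det_j C_g = Det_F A_g · Det_{F^ℂ}(½(I_F + (A_gᵀA_g)⁻¹ − iS_g))`, and this last
operator has positive-definite Hermitean real part. -/
theorem stmt17 {V : Type*} [AddCommGroup V] [Module ℝ V] [FiniteDimensional ℝ V]
    (Ω : V →ₗ[ℝ] V →ₗ[ℝ] ℝ)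
    (hΩalt : ∀ v, Ω v v = 0)
    (hΩnondeg : ∀ v, (∀ w, Ω v w = 0) → v = 0)
    (j : Module.End ℝ V)
    (hj2 : j * j = -1)
    (hjsymp : ∀ v w, Ω (j v) (j w) = Ω v w)
    (hjpos : ∀ v, v ≠ 0 → 0 < Ω v (j v))
    (F : Submodule ℝ V)
    (hFiso : ∀ v ∈ F, ∀ w ∈ F, Ω v w = 0)
    (hFdim : Module.finrank ℝ V = 2 * Module.finrank ℝ ↥F)
    (g : Module.End ℝ V)
    (hgbij : Function.Bijective g)
    (hgsymp : ∀ v w, Ω (g v) (g w) = Ω v w)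
    (hgF : ∀ v ∈ F, g v ∈ F)
    (A A' S : Module.End ℝ ↥F)
    (htri : IsTriangular Ω j F g A A' S)
    -- the identification of (V,j) with F^ℂ via v + jw ↦ v + iw
    (Φ : V ≃ₗ[ℝ] (ℂ ⊗[ℝ] ↥F))
    (hΦ : ∀ v w : ↥F, Φ ((v : V) + j (w : V))
        = (1 : ℂ) ⊗ₜ[ℝ] v + Complex.I ⊗ₜ[ℝ] w)
    -- the ℂ-linear endomorphism of F^ℂ corresponding to C_g under Φ
    (CC : ℂ ⊗[ℝ] ↥F →ₗ[ℂ] ℂ ⊗[ℝ] ↥F)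
    (hCC : ∀ x : V, CC (Φ x) = Φ (Cmap j g x))
    -- the Hermitean extension of G_j|_F to F^ℂ
    (h : (ℂ ⊗[ℝ] ↥F) → (ℂ ⊗[ℝ] ↥F) → ℂ)
    (hadd₁ : ∀ x y z, h (x + y) z = h x z + h y z)
    (hadd₂ : ∀ x y z, h x (y + z) = h x y + h x z)
    (hsmul₁ : ∀ (c : ℂ) x y, h (c • x) y = c * h x y)
    (hsmul₂ : ∀ (c : ℂ) x y, h x (c • y) = (starRingEnd ℂ) c * h x y)
    (hval : ∀ v w : ↥F,
      h ((1 : ℂ) ⊗ₜ[ℝ] v) ((1 : ℂ) ⊗ₜ[ℝ] w) = ((Ω (v : V) (j (w : V)) : ℝ) : ℂ)) :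
    CC = (LinearMap.baseChange ℂ A) ∘ₗ MHalf A A' S
    ∧ LinearMap.det CC = ((LinearMap.det A : ℝ) : ℂ) * LinearMap.det (MHalf A A' S)
    ∧ (∀ ξ : ℂ ⊗[ℝ] ↥F, ξ ≠ 0 → 0 < (h (MHalf A A' S ξ) ξ).re) := by
  obtain ⟨hA, hAA', hS, hg⟩ := htri
  have hjj : ∀ x, j (j x) = -x := fun x => by
    rw [← Module.End.mul_apply, hj2, LinearMap.neg_apply, Module.End.one_apply]
  have hcomp : CC = (LinearMap.baseChange ℂ A) ∘ₗ MHalf A A' S := by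
    refine linearMap_ext_one_tmul fun v => ?_
    have hv : Φ (v : V) = (1 : ℂ) ⊗ₜ[ℝ] v := by simpa using hΦ v 0
    have hgv : g (v : V) = A v := by simpa using hg v 0
    have hgjv : g (j (v : V)) = (A (S v) : V) + j (A' v : V) := by simpa using hg 0 v
    have hC : Cmap j g (v : V) = (((1 / 2 : ℝ) • (A v + A' v) : F) : V)
        + j (((-(1 / 2) : ℝ) • A (S v) : F) : V) := by
      simp only [Cmap, LinearMap.smul_apply, LinearMap.sub_apply, Module.End.mul_apply, hgv,
        hgjv, map_add, hjj, Submodule.coe_smul, Submodule.coe_add, map_smul]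
      module
    rw [← hv, hCC, hC, hΦ, hv]
    simp only [MHalf, LinearMap.comp_apply, LinearMap.smul_apply, LinearMap.sub_apply,
      LinearMap.add_apply, LinearMap.id_apply, map_add, map_sub, map_smul,
      LinearMap.baseChange_tmul, Module.End.mul_apply, ringInverse_apply_of_bijective hA,
      I_tmul_eq_smul, TensorProduct.tmul_smul, TensorProduct.tmul_add]
    module
  refine ⟨hcomp, ?_, fun ξ hξ => ?_⟩
  · rw [hcomp, LinearMap.det_comp, LinearMap.det_baseChange]
    rfl
  · have hskew : ∀ x y, Ω x y = -Ω y x := fun x y => by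
      have := hΩalt (x + y)
      simp only [map_add, LinearMap.add_apply, hΩalt] at this
      linarith
    have hGsymm : ∀ x y, Ω x (j y) = Ω y (j x) := fun x y => by
      rw [← hjsymp x (j y), hjj, map_neg, hskew y (j x)]
    have hGnonneg : ∀ x, 0 ≤ Ω x (j x) := fun x => by
      rcases eq_or_ne x 0 with rfl | hx
      · simp
      · exact (hjpos x hx).le
    have hinv : ∀ v : F, 0 ≤ Ω (Ring.inverse A (A' v) : F) (j (v : V)) := fun v => by
      rw [← hAA', ringInverse_apply_of_bijective hA]
      exact hGnonneg _
    obtain ⟨v, w, rfl⟩ := exists_one_tmul_add_I_tmul ξ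
    rw [re_hermitian_MHalf (fun v w : F => Ω (v : V) (j (w : V))) h hadd₁ hadd₂ hsmul₁ hsmul₂
      hval A A' S (fun v w => (hS v w).trans (hGsymm _ _)) v w]
    have hpos : 0 < Ω (v : V) (j (v : V)) + Ω (w : V) (j (w : V)) := by
      by_cases hv : v = 0
      · have hw : w ≠ 0 := by
          rintro rfl
          simp [hv] at hξ
        exact add_pos_of_nonneg_of_pos (hGnonneg _) (hjpos _ (by simpa using hw))
      · exact add_pos_of_pos_of_nonneg (hjpos _ (by simpa using hv)) (hGnonneg _)
    linarith [hinv v, hinv w]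
end

section
/- Let D ⊂ V be an isotropic subspace and j a positive compatible complex structure on (V,Ω). Then V = D^⊥ ⊕ jD; the subspace Q := (D + jD)^⊥ is stable under j and the restriction of Ω to Q is nondegenerate; the restriction to Q of the quotient map D^⊥ → D^⊥/D is a linear isomorphism which carries Ω|_Q to the induced symplectic form Ω′ on D^⊥/D; and the complex structure induced on D^⊥/D by j|_Q through this isomorphism is a positive compatible complex structure on (D^⊥/D, Ω′). -/
/-- The symplectic orthogonal `D^⊥ = {v : Ω(v,w) = 0 ∀ w ∈ D}`. -/
def symplOrth {V : Type*} [AddCommGroup V] [Module ℝ V]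
    (Ω : V →ₗ[ℝ] V →ₗ[ℝ] ℝ) (D : Submodule ℝ V) : Submodule ℝ V where
  carrier := {v | ∀ w ∈ D, Ω v w = 0}
  add_mem' := by
    intro a b ha hb w hw
    simp [map_add, LinearMap.add_apply, ha w hw, hb w hw]
  zero_mem' := by intro w hw; simp
  smul_mem' := by
    intro c x hx w hw
    simp [map_smul, LinearMap.smul_apply, hx w hw]

/-- The symplectic quotient `D^⊥/D`. -/
abbrev symplQuot {V : Type*} [AddCommGroup V] [Module ℝ V]
    (Ω : V →ₗ[ℝ] V →ₗ[ℝ] ℝ) (D : Submodule ℝ V) :=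
  ↥(symplOrth Ω D) ⧸ (D.comap (symplOrth Ω D).subtype)

/-- The quotient projection `π : D^⊥ → D^⊥/D`. -/
def symplProj {V : Type*} [AddCommGroup V] [Module ℝ V]
    (Ω : V →ₗ[ℝ] V →ₗ[ℝ] ℝ) (D : Submodule ℝ V) :
    ↥(symplOrth Ω D) →ₗ[ℝ] symplQuot Ω D :=
  (D.comap (symplOrth Ω D).subtype).mkQ

theorem mem_symplOrth {V : Type*} [AddCommGroup V] [Module ℝ V]
    {Ω : V →ₗ[ℝ] V →ₗ[ℝ] ℝ} {D : Submodule ℝ V} {v : V} :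
    v ∈ symplOrth Ω D ↔ ∀ w ∈ D, Ω v w = 0 :=
  Iff.rfl

theorem mem_symplOrth_sup_map {V : Type*} [AddCommGroup V] [Module ℝ V]
    {Ω : V →ₗ[ℝ] V →ₗ[ℝ] ℝ} {j : Module.End ℝ V} {D : Submodule ℝ V} {v : V} :
    v ∈ symplOrth Ω (D ⊔ D.map (j : V →ₗ[ℝ] V)) ↔
      (∀ d ∈ D, Ω v d = 0) ∧ ∀ d ∈ D, Ω v (j d) = 0 := by
  refine ⟨fun h => ⟨fun d hd => h d (Submodule.mem_sup_left hd), fun d hd =>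
    h _ (Submodule.mem_sup_right (Submodule.mem_map_of_mem hd))⟩, ?_⟩
  rintro ⟨h₁, h₂⟩ w hw
  obtain ⟨a, ha, b, ⟨d, hd, rfl⟩, rfl⟩ := Submodule.mem_sup.1 hw
  rw [map_add, h₁ a ha, h₂ d hd, add_zero]

/-- If `Ω (j s) s ≠ 0` for all nonzero `s`, then every vector decomposes along
`S^⊥` and `j S`. -/
theorem exists_sub_mem_symplOrth {V : Type*} [AddCommGroup V] [Module ℝ V]
    [FiniteDimensional ℝ V] (Ω : V →ₗ[ℝ] V →ₗ[ℝ] ℝ) (j : Module.End ℝ V)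
    (hj : ∀ v, Ω (j v) v = 0 → v = 0) (S : Submodule ℝ V) (v : V) :
    ∃ s ∈ S, v - j s ∈ symplOrth Ω S := by
  let f : S →ₗ[ℝ] Module.Dual ℝ S :=
    (Ω.compl₂ S.subtype) ∘ₗ j ∘ₗ S.subtype
  have hf : Function.Injective f := by
    rw [← LinearMap.ker_eq_bot, LinearMap.ker_eq_bot']
    intro s hs
    exact Subtype.ext (hj s (LinearMap.congr_fun hs s))
  have hsurj : Function.Surjective f :=
    (LinearMap.injective_iff_surjective_of_finrank_eq_finrank
      Subspace.dual_finrank_eq.symm).1 hf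
  obtain ⟨s, hs⟩ := hsurj (Ω v ∘ₗ S.subtype)
  refine ⟨s, s.2, fun w hw => ?_⟩
  have h : Ω (j s) w = Ω v w := LinearMap.congr_fun hs ⟨w, hw⟩
  rw [map_sub, LinearMap.sub_apply, h, sub_self]

/-- for an isotropic `D` and positive compatible `j`:
`V = D^⊥ ⊕ jD`; `Q := (D + jD)^⊥` is `j`-stable with `Ω|_Q` nondegenerate; the
projection `D^⊥ → D^⊥/D` restricts to an isomorphism on `Q` carrying `Ω|_Q` to
the induced form `Ω′`; and `j|_Q` induces a positive compatible complex
structure on `(D^⊥/D, Ω′)`. -/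
theorem stmt18 {V : Type*} [AddCommGroup V] [Module ℝ V] [FiniteDimensional ℝ V]
    (Ω : V →ₗ[ℝ] V →ₗ[ℝ] ℝ)
    (hΩalt : ∀ v, Ω v v = 0)
    (hΩnondeg : ∀ v, (∀ w, Ω v w = 0) → v = 0)
    (j : Module.End ℝ V)
    (hj2 : j * j = -1)
    (hjsymp : ∀ v w, Ω (j v) (j w) = Ω v w)
    (hjpos : ∀ v, v ≠ 0 → 0 < Ω v (j v))
    (D : Submodule ℝ V)
    (hDiso : ∀ v ∈ D, ∀ w ∈ D, Ω v w = 0)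
    -- Q := (D + jD)^⊥ is contained in D^⊥
    (hQle : symplOrth Ω (D ⊔ D.map (j : V →ₗ[ℝ] V)) ≤ symplOrth Ω D)
    -- the induced symplectic form Ω′ on the quotient D^⊥/D
    (Ω' : symplQuot Ω D → symplQuot Ω D → ℝ)
    (hΩ' : ∀ a b : ↥(symplOrth Ω D),
      Ω' (symplProj Ω D a) (symplProj Ω D b) = Ω (a : V) (b : V)) :
    -- V = D^⊥ ⊕ jD
    IsCompl (symplOrth Ω D) (D.map (j : V →ₗ[ℝ] V))
    -- Q is stable under j
    ∧ (∀ v ∈ symplOrth Ω (D ⊔ D.map (j : V →ₗ[ℝ] V)),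
        j v ∈ symplOrth Ω (D ⊔ D.map (j : V →ₗ[ℝ] V)))
    -- Ω restricted to Q is nondegenerate
    ∧ (∀ v ∈ symplOrth Ω (D ⊔ D.map (j : V →ₗ[ℝ] V)),
        (∀ w ∈ symplOrth Ω (D ⊔ D.map (j : V →ₗ[ℝ] V)), Ω v w = 0) → v = 0)
    -- the projection restricted to Q is a linear isomorphism onto D^⊥/D
    ∧ Function.Bijective
        (fun q : ↥(symplOrth Ω (D ⊔ D.map (j : V →ₗ[ℝ] V))) =>
          symplProj Ω D (Submodule.inclusion hQle q))
    -- it carries Ω|_Q to Ω′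
    ∧ (∀ q₁ q₂ : ↥(symplOrth Ω (D ⊔ D.map (j : V →ₗ[ℝ] V))),
        Ω' (symplProj Ω D (Submodule.inclusion hQle q₁))
            (symplProj Ω D (Submodule.inclusion hQle q₂))
          = Ω (q₁ : V) (q₂ : V))
    -- j|_Q induces a positive compatible complex structure on (D^⊥/D, Ω′)
    ∧ (∃ jQ : Module.End ℝ (symplQuot Ω D),
        (∀ (q : ↥(symplOrth Ω (D ⊔ D.map (j : V →ₗ[ℝ] V))))
            (hjq : j (q : V) ∈ symplOrth Ω (D ⊔ D.map (j : V →ₗ[ℝ] V))),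
          jQ (symplProj Ω D (Submodule.inclusion hQle q))
            = symplProj Ω D (Submodule.inclusion hQle ⟨j (q : V), hjq⟩))
        ∧ jQ * jQ = -1
        ∧ (∀ x y, Ω' (jQ x) (jQ y) = Ω' x y)
        ∧ (∀ x, x ≠ 0 → 0 < Ω' x (jQ x))) := by
  have hjj (v : V) : j (j v) = -v := by simpa using LinearMap.congr_fun hj2 v
  have hswap (v w : V) : Ω (j v) w = -Ω v (j w) := by
    rw [← hjsymp (j v) w, hjj, map_neg, LinearMap.neg_apply]
  have hdef (v : V) (hv : Ω v (j v) = 0) : v = 0 := by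
    by_contra h
    exact (hjpos v h).ne' hv
  have hdef' (v : V) (hv : Ω (j v) v = 0) : v = 0 :=
    hdef v (by rwa [hswap, neg_eq_zero] at hv)
  have hstable : ∀ v ∈ symplOrth Ω (D ⊔ D.map (j : V →ₗ[ℝ] V)),
      j v ∈ symplOrth Ω (D ⊔ D.map (j : V →ₗ[ℝ] V)) := by
    intro v hv
    rw [mem_symplOrth_sup_map] at hv ⊢
    exact ⟨fun d hd => by rw [hswap, hv.2 d hd, neg_zero],
      fun d hd => by rw [hjsymp, hv.1 d hd]⟩
  let p : ↥(symplOrth Ω (D ⊔ D.map (j : V →ₗ[ℝ] V))) →ₗ[ℝ] symplQuot Ω D :=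
    symplProj Ω D ∘ₗ Submodule.inclusion hQle
  have hp : Function.Bijective p := by
    constructor
    · rw [← LinearMap.ker_eq_bot, LinearMap.ker_eq_bot']
      intro q hq
      have hqD : (q : V) ∈ D := (Submodule.Quotient.mk_eq_zero (D.comap (symplOrth Ω D).subtype)).1 hq
      exact Subtype.ext (hdef q ((mem_symplOrth_sup_map.1 q.2).2 q hqD))
    · intro x
      obtain ⟨a, rfl⟩ := Submodule.mkQ_surjective _ x
      obtain ⟨s, ⟨d, hd, rfl⟩, hs⟩ :=
        exists_sub_mem_symplOrth Ω j hdef' (D.map (j : V →ₗ[ℝ] V)) (a : V)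
      rw [hjj, sub_neg_eq_add] at hs
      refine ⟨⟨a + d, mem_symplOrth_sup_map.2 ⟨fun w hw => ?_, fun w hw =>
        hs _ (Submodule.mem_map_of_mem hw)⟩⟩, ?_⟩
      · rw [map_add, LinearMap.add_apply, a.2 w hw, hDiso d hd w hw, add_zero]
      · refine (Submodule.Quotient.eq _).2 ?_
        simpa using hd
  have hpΩ (q₁ q₂ : ↥(symplOrth Ω (D ⊔ D.map (j : V →ₗ[ℝ] V)))) :
      Ω' (p q₁) (p q₂) = Ω (q₁ : V) (q₂ : V) := hΩ' _ _
  refine ⟨⟨?_, ?_⟩, hstable, fun v hv h => hdef v (h _ (hstable v hv)), hp, hpΩ, ?_⟩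
  · rw [Submodule.disjoint_def]
    rintro _ hv ⟨d, hd, rfl⟩
    rw [hdef' d (hv d hd), map_zero]
  · rw [codisjoint_iff, Submodule.eq_top_iff']
    intro v
    obtain ⟨d, hd, h⟩ := exists_sub_mem_symplOrth Ω j hdef' D v
    exact Submodule.mem_sup.2 ⟨_, h, _, Submodule.mem_map_of_mem hd, sub_add_cancel _ _⟩
  · let e := LinearEquiv.ofBijective p hp
    have hconj (q : ↥(symplOrth Ω (D ⊔ D.map (j : V →ₗ[ℝ] V)))) :
        e.conj (j.restrict hstable) (p q) = p (j.restrict hstable q) := by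
      rw [LinearEquiv.conj_apply_apply]
      change e (j.restrict hstable (e.symm (e q))) = _
      rw [e.symm_apply_apply]
      rfl
    refine ⟨e.conj (j.restrict hstable), fun q _ => hconj q, ?_, fun x y => ?_, fun x hx => ?_⟩
    · refine LinearMap.ext fun x => ?_
      obtain ⟨q, rfl⟩ := hp.2 x
      rw [Module.End.mul_apply, hconj, hconj, LinearMap.neg_apply, Module.End.one_apply, ← map_neg]
      exact congrArg p (Subtype.ext (hjj q))
    · obtain ⟨q, rfl⟩ := hp.2 x
      obtain ⟨r, rfl⟩ := hp.2 y
      rw [hconj, hconj, hpΩ, hpΩ]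
      exact hjsymp q r
    · obtain ⟨q, rfl⟩ := hp.2 x
      rw [hconj, hpΩ]
      refine hjpos q fun h => hx ?_
      rw [show q = 0 from Subtype.ext h, map_zero]
end
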